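/- As x → ∞, the number of x-pseudosquares in the interval (0, M(x)] satisfies #(S_x ∩ (0, M(x)]) = (1+o(1)) · M(x) / (2^{π(x)+1} e^γ log x). -/

import Mathlib

open scoped BigOperators

/-- The finset of primes `p ≤ x`. -/
noncomputable def primesUpTo (x : ℝ) : Finset ℕ := (Finset.Iic ⌊x⌋₊).filter Nat.Prime

/-- `M(x)`: the product of all primes `p ≤ x`. -/
noncomputable def Mx (x : ℝ) : ℕ := ∏ p ∈ primesUpTo x, p

/-- `π(x)`: the number of primes `p ≤ x`. -/
noncomputable def piX (x : ℝ) : ℕ := (primesUpTo x).card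

/-- The Legendre symbol `(a/p)` (junk value `0` if `p` is not prime). -/
noncomputable def legendre (p : ℕ) (a : ℤ) : ℤ :=
  if hp : p.Prime then @legendreSym p ⟨hp⟩ a else 0

/-- An `x`-pseudosquare: a positive integer that is not a perfect square, is `≡ 1 (mod 8)`,
and has Legendre symbol `(n/p) = 1` for every odd prime `p ≤ x`. -/
def IsPseudosquare (x : ℝ) (n : ℕ) : Prop :=
  0 < n ∧ ¬ IsSquare n ∧ n % 8 = 1 ∧
    ∀ p : ℕ, p.Prime → p ≠ 2 → (p : ℝ) ≤ x → legendre p (n : ℤ) = 1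

/-- `#(S_x ∩ (A, A+N])`: the number of `x`-pseudosquares in the interval `(A, A+N]`. -/
noncomputable def pseudosquaresIn (x A N : ℝ) : ℕ :=
  Set.ncard {n : ℕ | IsPseudosquare x n ∧ A < (n : ℝ) ∧ (n : ℝ) ≤ A + N}

open Filter Topology

/-- **Mertens' first theorem** for the von Mangoldt function. -/
theorem exists_abs_sum_vonMangoldt_div_sub_log_le :
    ∃ C : ℝ, ∀ N : ℕ, N ≠ 0 →
      |∑ n ∈ Finset.Ioc 0 N, ArithmeticFunction.vonMangoldt n / n - Real.log N| ≤ C := by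
  refine ⟨Real.log 4 + 4, fun N hN ↦ ?_⟩
  have hN0 : (0 : ℝ) < N := by positivity
  have hfact : Real.log N.factorial =
      ∑ n ∈ Finset.Ioc 0 N, ArithmeticFunction.vonMangoldt n * ((N / n : ℕ) : ℝ) := by
    rw [← ArithmeticFunction.sum_Ioc_mul_zeta_eq_sum, ArithmeticFunction.vonMangoldt_mul_zeta,
      ← Finset.prod_Ico_id_eq_factorial, Nat.cast_prod, Real.log_prod]
    · exact Finset.sum_congr (by ext; simp; omega) fun n _ ↦ rfl
    · intro i hi
      have := (Finset.mem_Ico.1 hi).1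
      positivity
  have hup : Real.log N.factorial ≤ N * ∑ n ∈ Finset.Ioc 0 N,
      ArithmeticFunction.vonMangoldt n / n := by
    rw [hfact, Finset.mul_sum]
    refine Finset.sum_le_sum fun n _ ↦ ?_
    have h1 : ((N / n : ℕ) : ℝ) ≤ N / n := Nat.cast_div_le
    have h2 : 0 ≤ ArithmeticFunction.vonMangoldt n := ArithmeticFunction.vonMangoldt_nonneg
    calc _ ≤ ArithmeticFunction.vonMangoldt n * (N / n : ℝ) := by gcongr
      _ = _ := by ring
  have hlow : N * ∑ n ∈ Finset.Ioc 0 N, ArithmeticFunction.vonMangoldt n / n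
      - Chebyshev.psi N ≤ Real.log N.factorial := by
    rw [hfact, Finset.mul_sum, Chebyshev.psi, Nat.floor_natCast, ← Finset.sum_sub_distrib]
    refine Finset.sum_le_sum fun n hn ↦ ?_
    have h1 : (N / n : ℝ) - 1 ≤ ((N / n : ℕ) : ℝ) := by
      have := Nat.lt_floor_add_one ((N : ℝ) / n)
      rw [Nat.floor_div_eq_div] at this
      linarith
    have h2 : 0 ≤ ArithmeticFunction.vonMangoldt n := ArithmeticFunction.vonMangoldt_nonneg
    calc _ = ArithmeticFunction.vonMangoldt n * (N / n - 1 : ℝ) := by ring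
      _ ≤ _ := by gcongr
  have hstir := Stirling.le_log_factorial_stirling hN
  have hl0 : 0 ≤ Real.log N := Real.log_natCast_nonneg N
  have hpi : 0 ≤ Real.log (2 * Real.pi) := Real.log_nonneg (by nlinarith [Real.pi_gt_three])
  have hfu : Real.log N.factorial ≤ N * Real.log N := by
    rw [← Real.log_pow]
    exact Real.log_le_log (by positivity) (by exact_mod_cast Nat.factorial_le_pow N)
  have hpsi := Chebyshev.psi_le_const_mul_self hN0.le
  have h4 : 0 ≤ Real.log 4 := Real.log_nonneg (by norm_num)
  rw [abs_le]
  constructor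
  · refine le_of_mul_le_mul_left ?_ hN0
    nlinarith
  · refine le_of_mul_le_mul_left ?_ hN0
    nlinarith

/-- **Mertens' first theorem** for primes. -/
theorem exists_abs_sum_log_prime_div_sub_log_le :
    ∃ C : ℝ, ∀ N : ℕ, N ≠ 0 →
      |∑ n ∈ Finset.Ioc 0 N, (if n.Prime then Real.log n / n else 0) - Real.log N| ≤ C := by
  obtain ⟨C, hC⟩ := exists_abs_sum_vonMangoldt_div_sub_log_le
  have hs := ArithmeticFunction.vonMangoldt.summable_residueClass_non_primes_div (q := 1) 0
  set g : ℕ → ℝ := fun n ↦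
    (if Nat.Prime n then 0 else ArithmeticFunction.vonMangoldt.residueClass (0 : ZMod 1) n) / n
  have hres : ∀ n, ArithmeticFunction.vonMangoldt.residueClass (0 : ZMod 1) n =
      ArithmeticFunction.vonMangoldt n := fun n ↦ by
    simp only [ArithmeticFunction.vonMangoldt.residueClass]
    rw [Set.indicator_of_mem]
    exact Subsingleton.elim _ _
  have hg : ∀ n, 0 ≤ g n := fun n ↦ by
    simp only [g, hres]
    split_ifs
    · simp
    · exact div_nonneg ArithmeticFunction.vonMangoldt_nonneg (by positivity)
  refine ⟨C + ∑' n, g n, fun N hN ↦ ?_⟩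
  have hsplit : ∑ n ∈ Finset.Ioc 0 N, ArithmeticFunction.vonMangoldt n / n =
      ∑ n ∈ Finset.Ioc 0 N, (if n.Prime then Real.log n / n else 0) +
        ∑ n ∈ Finset.Ioc 0 N, g n := by
    rw [← Finset.sum_add_distrib]
    refine Finset.sum_congr rfl fun n _ ↦ ?_
    by_cases hn : n.Prime
    · simp [g, hn, ArithmeticFunction.vonMangoldt_apply_prime hn]
    · simp [g, hn, hres]
  have h1 := hs.sum_le_tsum (Finset.Ioc 0 N) fun i _ ↦ hg i
  have h2 : 0 ≤ ∑ n ∈ Finset.Ioc 0 N, g n := Finset.sum_nonneg fun i _ ↦ hg i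
  have h3 := abs_le.1 (hC N hN)
  rw [hsplit] at h3
  rw [abs_le]
  constructor <;> linarith [h3.1, h3.2]

theorem exists_tendsto_sum_log_sub_log_div_log :
    ∃ C : ℝ, Tendsto (fun n : ℕ ↦
      ∑ i ∈ Finset.range (n + 1), (Real.log (i + 2) - Real.log (i + 1)) / Real.log (i + 2)
        - Real.log (Real.log (n + 2))) atTop (𝓝 C) := by
  set D : ℕ → ℝ := fun i ↦ Real.log (Real.log (i + 3)) - Real.log (Real.log (i + 2))
    - (Real.log (i + 3) - Real.log (i + 2)) / Real.log (i + 3)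
  have hpos : ∀ i : ℕ, 0 < Real.log (i + 2) := fun i ↦
    Real.log_pos (by have : (0 : ℝ) ≤ i := by positivity
                     linarith)
  have hpos' : ∀ i : ℕ, 0 < Real.log (i + 3) := fun i ↦
    Real.log_pos (by have : (0 : ℝ) ≤ i := by positivity
                     linarith)
  have hle : ∀ i : ℕ, Real.log (i + 2) ≤ Real.log (i + 3) := fun i ↦
    Real.log_le_log (by positivity) (by linarith)
  have hD0 : ∀ i, 0 ≤ D i := fun i ↦ by
    have h := Real.log_le_sub_one_of_pos (div_pos (hpos i) (hpos' i))
    rw [Real.log_div (hpos i).ne' (hpos' i).ne'] at h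
    have : (Real.log (i + 3) - Real.log (i + 2)) / Real.log (i + 3) =
      1 - Real.log (i + 2) / Real.log (i + 3) := by
        have := (hpos' i).ne'
        field_simp
    simp only [D, this]
    linarith
  have hD1 : ∀ i, D i ≤ 1 / Real.log (i + 2) - 1 / Real.log (i + 3) := fun i ↦ by
    have h := Real.log_le_sub_one_of_pos (div_pos (hpos' i) (hpos i))
    rw [Real.log_div (hpos' i).ne' (hpos i).ne'] at h
    have hΔ : Real.log (i + 3) - Real.log (i + 2) ≤ 1 := by
      have h' := Real.log_le_sub_one_of_pos
        (div_pos (by positivity : (0 : ℝ) < i + 3) (by positivity : (0 : ℝ) < i + 2))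
      rw [Real.log_div (by positivity) (by positivity)] at h'
      have : ((i : ℝ) + 3) / (i + 2) ≤ 2 := by
        rw [div_le_iff₀ (by positivity)]
        have : (0 : ℝ) ≤ i := by positivity
        linarith
      linarith
    have hinv : 0 ≤ 1 / Real.log (i + 2) - 1 / Real.log (i + 3) :=
      sub_nonneg.2 (one_div_le_one_div_of_le (hpos i) (hle i))
    have hkey : D i ≤ (Real.log (i + 3) - Real.log (i + 2)) *
        (1 / Real.log (i + 2) - 1 / Real.log (i + 3)) := by
      have : (Real.log (i + 3) - Real.log (i + 2)) *
        (1 / Real.log (i + 2) - 1 / Real.log (i + 3)) = Real.log (i + 3) / Real.log (i + 2) - 1 -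
          (Real.log (i + 3) - Real.log (i + 2)) / Real.log (i + 3) := by
        have := (hpos' i).ne'
        have := (hpos i).ne'
        field_simp
      rw [this]
      simp only [D]
      linarith
    nlinarith
  have hsum : Summable D := by
    refine summable_of_sum_range_le (c := 1 / Real.log 2) hD0 fun n ↦ ?_
    calc ∑ i ∈ Finset.range n, D i
        ≤ ∑ i ∈ Finset.range n, (1 / Real.log (i + 2) - 1 / Real.log ((i + 1 : ℕ) + 2)) := by
          refine Finset.sum_le_sum fun i _ ↦ (hD1 i).trans_eq ?_
          push_cast
          ring_nf
      _ = 1 / Real.log 2 - 1 / Real.log (n + 2) := by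
          rw [Finset.sum_range_sub' (fun i : ℕ ↦ 1 / Real.log ((i : ℝ) + 2))]
          simp
      _ ≤ 1 / Real.log 2 := by
          have := (hpos n).le
          simp only [one_div, sub_le_self_iff, inv_nonneg, this]
  refine ⟨1 - Real.log (Real.log 2) - ∑' i, D i, ?_⟩
  have h := (tendsto_const_nhds (x := 1 - Real.log (Real.log 2))).sub hsum.hasSum.tendsto_sum_nat
  refine h.congr fun n ↦ ?_
  rw [Finset.sum_range_succ']
  have e : ∑ i ∈ Finset.range n, D i = Real.log (Real.log (n + 2)) - Real.log (Real.log 2) -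
      ∑ i ∈ Finset.range n, (Real.log ((i + 1 : ℕ) + 2) - Real.log ((i + 1 : ℕ) + 1)) /
        Real.log ((i + 1 : ℕ) + 2) := by
    have t := Finset.sum_range_sub (fun i : ℕ ↦ Real.log (Real.log ((i : ℝ) + 2))) n
    simp only [Nat.cast_zero, zero_add] at t
    rw [← t, ← Finset.sum_sub_distrib]
    refine Finset.sum_congr rfl fun i _ ↦ ?_
    simp only [D]
    push_cast
    ring_nf
  rw [e]
  have : Real.log 2 ≠ 0 := by positivity
  simp [this]
  ring

/-- **Mertens' second theorem**, without identification of the constant. -/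
theorem exists_tendsto_sum_prime_inv_sub_log_log :
    ∃ C : ℝ, Tendsto (fun N : ℕ ↦
      ∑ n ∈ Finset.Ioc 0 N, (if n.Prime then (n : ℝ)⁻¹ else 0) - Real.log (Real.log N))
        atTop (𝓝 C) := by
  obtain ⟨K, hK⟩ := exists_abs_sum_log_prime_div_sub_log_le
  obtain ⟨C₁, hC₁⟩ := exists_tendsto_sum_log_sub_log_div_log
  have hpos : ∀ i : ℕ, 0 < Real.log (i + 2) := fun i ↦
    Real.log_pos (by have : (0 : ℝ) ≤ i := by positivity
                     linarith)
  have hshift : ∀ (f : ℕ → ℝ), f 1 = 0 → ∀ n : ℕ,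
      ∑ k ∈ Finset.Ioc 0 (n + 1), f k = ∑ i ∈ Finset.range n, f (i + 2) := fun f hf n ↦ by
    induction n with
    | zero => simp [hf]
    | succ n ih =>
      rw [← Finset.insert_Ioc_right_eq_Ioc_add_one (by omega), Finset.sum_insert (by simp), ih,
        Finset.sum_range_succ _ n, add_comm]
      rfl
  set z : ℕ → ℝ := fun i ↦
    (if (i + 2).Prime then Real.log ((i + 2 : ℕ) : ℝ) / ((i + 2 : ℕ) : ℝ) else 0)
      - (Real.log (i + 2) - Real.log (i + 1))
  have hz : ∀ n, ‖∑ i ∈ Finset.range n, z i‖ ≤ K := fun n ↦ by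
    have h := hK (n + 1) (by omega)
    rw [hshift _ (by simp)] at h
    have t := Finset.sum_range_sub (fun i : ℕ ↦ Real.log ((i : ℝ) + 1)) n
    simp only [Nat.cast_zero, zero_add, Real.log_one, sub_zero] at t
    rw [Real.norm_eq_abs]
    convert h using 2
    simp only [z]
    rw [Finset.sum_sub_distrib]
    congr 1
    rw [Nat.cast_add_one, ← t]
    refine Finset.sum_congr rfl fun i _ ↦ ?_
    push_cast
    ring_nf
  have hanti : Antitone fun i : ℕ ↦ (Real.log (i + 2))⁻¹ := fun i j hij ↦ by
    refine inv_anti₀ (hpos i) (Real.log_le_log (by positivity) ?_)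
    have : (i : ℝ) ≤ j := by exact_mod_cast hij
    linarith
  have hzero : Tendsto (fun i : ℕ ↦ (Real.log ((i : ℝ) + 2))⁻¹) atTop (𝓝 0) :=
    tendsto_inv_atTop_zero.comp (Real.tendsto_log_atTop.comp
      (tendsto_atTop_add_const_right _ _ tendsto_natCast_atTop_atTop))
  obtain ⟨C₂, hC₂⟩ := cauchySeq_tendsto_of_complete
    (hanti.cauchySeq_series_mul_of_tendsto_zero_of_bounded hzero hz)
  refine ⟨C₂ + C₁, ?_⟩
  rw [← tendsto_add_atTop_iff_nat 2]
  refine ((hC₂.comp (tendsto_add_atTop_nat 1)).add hC₁).congr fun n ↦ ?_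
  rw [hshift _ (by simp [Nat.not_prime_one])]
  simp only [Function.comp]
  rw [← add_sub_assoc, ← Finset.sum_add_distrib]
  push_cast
  congr 1
  refine Finset.sum_congr rfl fun i _ ↦ ?_
  have h1 := (hpos i).ne'
  simp only [z, smul_eq_mul]
  split_ifs
  · push_cast
    field_simp
    ring
  · field_simp
    ring

/-- The sum of the reciprocals of the primes `p ≤ x`. -/
noncomputable def primeInvSum (x : ℝ) : ℝ :=
  ∑ n ∈ Finset.Ioc 0 ⌊x⌋₊, (if n.Prime then (n : ℝ)⁻¹ else 0)

theorem primeInvSum_mono : Monotone primeInvSum := fun x y hxy ↦ by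
  refine Finset.sum_le_sum_of_subset_of_nonneg
    (Finset.Ioc_subset_Ioc_right (Nat.floor_mono hxy)) fun i _ _ ↦ ?_
  split_ifs <;> positivity

theorem primeInvSum_nonneg (x : ℝ) : 0 ≤ primeInvSum x :=
  Finset.sum_nonneg fun i _ ↦ by split_ifs <;> positivity

theorem exists_tendsto_primeInvSum_sub_log_log :
    ∃ C : ℝ, Tendsto (fun x : ℝ ↦ primeInvSum x - Real.log (Real.log x)) atTop (𝓝 C) := by
  obtain ⟨C, hC⟩ := exists_tendsto_sum_prime_inv_sub_log_log
  refine ⟨C, ?_⟩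
  have hfl := hC.comp (tendsto_nat_floor_atTop (α := ℝ))
  have hlog : Tendsto (fun x : ℝ ↦ (Real.log ⌊x⌋₊)⁻¹) atTop (𝓝 0) :=
    tendsto_inv_atTop_zero.comp (Real.tendsto_log_atTop.comp
      (tendsto_natCast_atTop_atTop.comp (tendsto_nat_floor_atTop (α := ℝ))))
  have hdiff : Tendsto (fun x : ℝ ↦ Real.log (Real.log x) - Real.log (Real.log ⌊x⌋₊))
      atTop (𝓝 0) := by
    refine squeeze_zero' ?_ ?_ hlog
    all_goals
      filter_upwards [eventually_ge_atTop 2] with x hx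
      have hn : (2 : ℝ) ≤ ⌊x⌋₊ := by exact_mod_cast Nat.le_floor (by exact_mod_cast hx)
      have hnx : (⌊x⌋₊ : ℝ) ≤ x := Nat.floor_le (by linarith)
      have hxn : x < ⌊x⌋₊ + 1 := Nat.lt_floor_add_one x
      have hl : 0 < Real.log ⌊x⌋₊ := Real.log_pos (by linarith)
      have hll : Real.log ⌊x⌋₊ ≤ Real.log x := Real.log_le_log (by linarith) hnx
    · exact sub_nonneg.2 (Real.log_le_log hl hll)
    · rw [← Real.log_div (by linarith) hl.ne']
      refine (Real.log_le_sub_one_of_pos (div_pos (by linarith) hl)).trans ?_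
      have h1 : Real.log x - Real.log ⌊x⌋₊ ≤ 1 := by
        rw [← Real.log_div (by linarith) (by linarith)]
        refine (Real.log_le_sub_one_of_pos (div_pos (by linarith) (by linarith))).trans ?_
        have : x / ⌊x⌋₊ ≤ 2 := by
          rw [div_le_iff₀ (by linarith)]
          linarith
        linarith
      calc Real.log x / Real.log ⌊x⌋₊ - 1
          = (Real.log x - Real.log ⌊x⌋₊) * (Real.log ⌊x⌋₊)⁻¹ := by field_simp
        _ ≤ 1 * (Real.log ⌊x⌋₊)⁻¹ := by gcongr
        _ = _ := one_mul _
  have := hfl.sub hdiff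
  rw [sub_zero] at this
  refine this.congr fun x ↦ ?_
  simp only [Function.comp, primeInvSum]
  ring

theorem exists_abs_primeInvSum_exp_sub_log_sub_le {C : ℝ}
    (hC : Tendsto (fun x : ℝ ↦ primeInvSum x - Real.log (Real.log x)) atTop (𝓝 C)) :
    ∃ K : ℝ, (∀ u, 1 ≤ u → |primeInvSum (Real.exp u) - Real.log u - C| ≤ K) ∧
      ∀ u, 0 < u → u ≤ 1 → |primeInvSum (Real.exp u) - Real.log u - C| ≤ K + |Real.log u| := by
  have h := (hC.comp Real.tendsto_exp_atTop).sub_const C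
  simp only [sub_self, Function.comp_def, Real.log_exp] at h
  obtain ⟨U, hU⟩ := eventually_atTop.1 (h.abs.eventually_le_const (by norm_num : |(0 : ℝ)| < 1))
  set V := max U 1
  have hV : 0 ≤ Real.log V := Real.log_nonneg (le_max_right _ _)
  have hS := primeInvSum_nonneg (Real.exp V)
  refine ⟨1 + primeInvSum (Real.exp V) + Real.log V + |C|, fun u hu ↦ ?_, fun u hu hu1 ↦ ?_⟩
  · rcases le_total U u with hUu | hUu
    · exact (hU u hUu).trans (by linarith [abs_nonneg C])
    · have h1 : primeInvSum (Real.exp u) ≤ primeInvSum (Real.exp V) :=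
        primeInvSum_mono (Real.exp_le_exp.2 (hUu.trans (le_max_left _ _)))
      have h2 : Real.log u ≤ Real.log V := Real.log_le_log (by linarith)
        (hUu.trans (le_max_left _ _))
      have h3 := Real.log_nonneg hu
      have h4 := primeInvSum_nonneg (Real.exp u)
      rw [abs_le]
      constructor <;> linarith [neg_abs_le C, le_abs_self C]
  · have h1 : primeInvSum (Real.exp u) ≤ primeInvSum (Real.exp V) :=
      primeInvSum_mono (Real.exp_le_exp.2 (hu1.trans (le_max_right _ _)))
    have h4 := primeInvSum_nonneg (Real.exp u)
    rw [abs_le]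
    constructor <;> linarith [neg_abs_le C, le_abs_self C, neg_abs_le (Real.log u),
      le_abs_self (Real.log u)]

theorem integral_exp_neg_mul_log :
    ∫ v in Set.Ioi (0 : ℝ), Real.exp (-v) * Real.log v = -Real.eulerMascheroniConstant := by
  have h := Complex.hasDerivAt_GammaIntegral (s := 1) (by simp)
  have h' : HasDerivAt Complex.GammaIntegral (-(Real.eulerMascheroniConstant : ℂ)) 1 := by
    refine Complex.hasDerivAt_Gamma_one.congr_of_eventuallyEq ?_
    filter_upwards [(isOpen_Ioi.preimage Complex.continuous_re).mem_nhds
      (show (1 : ℂ) ∈ Complex.re ⁻¹' Set.Ioi 0 by simp)] with s hs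
    exact (Complex.Gamma_eq_integral hs).symm
  have e := h.unique h'
  rw [← Complex.ofReal_inj, Complex.ofReal_neg, ← e, ← integral_complex_ofReal]
  refine MeasureTheory.setIntegral_congr_fun measurableSet_Ioi fun v _ ↦ ?_
  simp [mul_comm]

theorem integrableOn_exp_neg_mul_log :
    MeasureTheory.IntegrableOn (fun v ↦ Real.exp (-v) * Real.log v) (Set.Ioi 0) := by
  by_contra h
  have := MeasureTheory.integral_undef h
  rw [integral_exp_neg_mul_log] at this
  linarith [Real.one_half_lt_eulerMascheroniConstant]

theorem measurable_primeInvSum : Measurable primeInvSum := primeInvSum_mono.measurable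

theorem tendsto_integral_exp_neg_mul_primeInvSum {C : ℝ}
    (hC : Tendsto (fun x : ℝ ↦ primeInvSum x - Real.log (Real.log x)) atTop (𝓝 C)) :
    Tendsto (fun δ : ℝ ↦
      (∫ v in Set.Ioi (0 : ℝ), Real.exp (-v) * primeInvSum (Real.exp (v / δ))) + Real.log δ)
        (𝓝[>] 0) (𝓝 (C - Real.eulerMascheroniConstant)) := by
  obtain ⟨K, hK1, hK2⟩ := exists_abs_primeInvSum_exp_sub_log_sub_le hC
  set R : ℝ → ℝ := fun u ↦ primeInvSum (Real.exp u) - Real.log u - C with hR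
  have hRm : Measurable R := by
    have := measurable_primeInvSum.comp Real.measurable_exp
    exact (this.sub Real.measurable_log).sub_const C
  have hRlim : Tendsto R atTop (𝓝 0) := by
    have h := (hC.comp Real.tendsto_exp_atTop).sub_const C
    simpa only [sub_self, Function.comp_def, Real.log_exp] using h
  have hexp : MeasureTheory.IntegrableOn (fun v ↦ Real.exp (-v)) (Set.Ioi 0) :=
    integrableOn_exp_neg_Ioi 0
  set bound : ℝ → ℝ := fun v ↦ Real.exp (-v) * K + |Real.exp (-v) * Real.log v|
  have hbound : MeasureTheory.IntegrableOn bound (Set.Ioi 0) :=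
    (hexp.mul_const K).add integrableOn_exp_neg_mul_log.abs
  have hle : ∀ δ : ℝ, 0 < δ → δ ≤ 1 → ∀ v, 0 < v →
      ‖Real.exp (-v) * R (v / δ)‖ ≤ bound v := fun δ hδ hδ1 v hv ↦ by
    have hu : 0 < v / δ := div_pos hv hδ
    have hRb : |R (v / δ)| ≤ K + |Real.log v| := by
      rcases le_total 1 (v / δ) with h1 | h1
      · exact (hK1 _ h1).trans (le_add_of_nonneg_right (abs_nonneg _))
      · refine (hK2 _ hu h1).trans ?_
        have hvu : v ≤ v / δ := by
          rw [le_div_iff₀ hδ]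
          nlinarith
        have h2 : Real.log v ≤ Real.log (v / δ) := Real.log_le_log hv hvu
        have h3 : Real.log (v / δ) ≤ 0 := Real.log_nonpos hu.le h1
        rw [abs_of_nonpos h3, abs_of_nonpos (h2.trans h3)]
        linarith
    simp only [bound]
    rw [norm_mul, Real.norm_eq_abs, Real.norm_eq_abs, abs_mul, Real.abs_exp, ← mul_add]
    gcongr
  have hmeas : ∀ δ : ℝ, MeasureTheory.AEStronglyMeasurable
      (fun v ↦ Real.exp (-v) * R (v / δ)) (MeasureTheory.volume.restrict (Set.Ioi 0)) :=
    fun δ ↦ ((Real.measurable_exp.comp measurable_neg).mul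
      (hRm.comp (measurable_id.div_const δ))).aestronglyMeasurable
  have hev : ∀ᶠ δ : ℝ in 𝓝[>] 0, 0 < δ ∧ δ ≤ 1 := by
    filter_upwards [Ioc_mem_nhdsGT (zero_lt_one' ℝ)] with δ hδ using hδ
  have hlim : Tendsto (fun δ : ℝ ↦ ∫ v in Set.Ioi (0 : ℝ), Real.exp (-v) * R (v / δ))
      (𝓝[>] 0) (𝓝 0) := by
    have := MeasureTheory.tendsto_integral_filter_of_dominated_convergence
      (μ := MeasureTheory.volume.restrict (Set.Ioi (0 : ℝ))) (l := 𝓝[>] (0 : ℝ))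
      (F := fun δ v ↦ Real.exp (-v) * R (v / δ)) (f := fun _ ↦ (0 : ℝ)) bound
      (Eventually.of_forall hmeas) ?_ hbound ?_
    · simpa using this
    · filter_upwards [hev] with δ hδ
      filter_upwards [MeasureTheory.self_mem_ae_restrict measurableSet_Ioi] with v hv
      exact hle δ hδ.1 hδ.2 v hv
    · filter_upwards [MeasureTheory.self_mem_ae_restrict measurableSet_Ioi] with v hv
      have h1 : Tendsto (fun δ : ℝ ↦ v / δ) (𝓝[>] 0) atTop := by
        simpa only [div_eq_mul_inv] using tendsto_inv_nhdsGT_zero.const_mul_atTop hv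
      simpa using (hRlim.comp h1).const_mul (Real.exp (-v))
  have := hlim.add_const (C - Real.eulerMascheroniConstant)
  rw [zero_add] at this
  refine this.congr' ?_
  filter_upwards [hev] with δ hδ
  have hintegrable : MeasureTheory.IntegrableOn (fun v ↦ Real.exp (-v) * R (v / δ)) (Set.Ioi 0) := by
    refine hbound.mono' (hmeas δ) ?_
    filter_upwards [MeasureTheory.self_mem_ae_restrict measurableSet_Ioi] with v hv
    exact hle δ hδ.1 hδ.2 v hv
  have hsplit : ∫ v in Set.Ioi (0 : ℝ), Real.exp (-v) * primeInvSum (Real.exp (v / δ)) =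
      ∫ v in Set.Ioi (0 : ℝ), (Real.exp (-v) * R (v / δ) + Real.exp (-v) * Real.log v +
        Real.exp (-v) * (C - Real.log δ)) := by
    refine MeasureTheory.setIntegral_congr_fun measurableSet_Ioi fun v (hv : 0 < v) ↦ ?_
    simp only [hR]
    rw [Real.log_div hv.ne' hδ.1.ne']
    ring
  have hintegrable' : MeasureTheory.IntegrableOn
      (fun v ↦ Real.exp (-v) * R (v / δ) + Real.exp (-v) * Real.log v) (Set.Ioi 0) :=
    hintegrable.add integrableOn_exp_neg_mul_log
  rw [hsplit, MeasureTheory.integral_add hintegrable' (hexp.mul_const _),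
    MeasureTheory.integral_add hintegrable integrableOn_exp_neg_mul_log,
    integral_exp_neg_mul_log, MeasureTheory.integral_mul_const, integral_exp_neg_Ioi_zero]
  ring

theorem summable_ite_prime_rpow {s : ℝ} (hs : 1 < s) :
    Summable fun n : ℕ ↦ (if n.Prime then (n : ℝ) ^ (-s) else 0) := by
  refine Summable.of_nonneg_of_le (fun n ↦ ?_) (fun n ↦ ?_)
    (Real.summable_nat_rpow.2 (by linarith : -s < -1))
  · split_ifs <;> positivity
  · split_ifs
    · rfl
    · positivity

theorem tsum_prime_rpow_eq_integral {δ : ℝ} (hδ : 0 < δ) :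
    ∑' n : ℕ, (if n.Prime then (n : ℝ) ^ (-(1 + δ)) else 0) =
      ∫ v in Set.Ioi (0 : ℝ), Real.exp (-v) * primeInvSum (Real.exp (v / δ)) := by
  set F : ℕ → ℝ → ℝ := fun n ↦ Set.indicator (Set.Ici (δ * Real.log n))
    (fun v ↦ (if n.Prime then (n : ℝ)⁻¹ else 0) * Real.exp (-v)) with hF
  have hexp : ∀ a : ℝ, MeasureTheory.IntegrableOn (fun v ↦ Real.exp (-v)) (Set.Ioi a) :=
    integrableOn_exp_neg_Ioi
  have hintegrable : ∀ n, MeasureTheory.IntegrableOn (F n) (Set.Ioi 0) := fun n ↦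
    (((hexp 0).const_mul _).indicator measurableSet_Ici)
  have hnonneg : ∀ n v, 0 ≤ F n v := fun n v ↦ by
    refine Set.indicator_nonneg (fun v _ ↦ ?_) v
    split_ifs <;> positivity
  have hval : ∀ n, ∫ v in Set.Ioi (0 : ℝ), F n v =
      if n.Prime then (n : ℝ) ^ (-(1 + δ)) else 0 := fun n ↦ by
    by_cases hn : n.Prime
    · have hn1 : (1 : ℝ) < n := by exact_mod_cast hn.one_lt
      have hl : 0 < δ * Real.log n := mul_pos hδ (Real.log_pos hn1)
      simp only [hF, hn, if_true]
      rw [MeasureTheory.setIntegral_indicator measurableSet_Ici,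
        Set.inter_eq_right.2 (Set.Ici_subset_Ioi.2 hl),
        MeasureTheory.integral_Ici_eq_integral_Ioi, MeasureTheory.integral_const_mul,
        integral_exp_neg_Ioi, Real.rpow_neg (by linarith), Real.rpow_add (by linarith),
        Real.rpow_one, mul_inv, Real.rpow_def_of_pos (by linarith), ← Real.exp_neg]
      ring_nf
    · simp [hF, hn]
  have h := MeasureTheory.hasSum_integral_of_summable_integral_norm hintegrable (by
    simp only [Real.norm_of_nonneg (hnonneg _ _), hval]
    exact summable_ite_prime_rpow (by linarith))
  simp only [hval] at h
  rw [h.tsum_eq]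
  refine MeasureTheory.setIntegral_congr_fun measurableSet_Ioi fun v (hv : 0 < v) ↦ ?_
  rw [tsum_eq_sum (s := Finset.Ioc 0 ⌊Real.exp (v / δ)⌋₊), primeInvSum, Finset.mul_sum]
  · refine Finset.sum_congr rfl fun n hn ↦ ?_
    obtain ⟨hn0, hn1⟩ := Finset.mem_Ioc.1 hn
    have h1 : (n : ℝ) ≤ Real.exp (v / δ) := (Nat.le_floor_iff (Real.exp_nonneg _)).1 hn1
    have h2 : Real.log n ≤ v / δ := (Real.log_le_iff_le_exp (by positivity)).2 h1
    rw [le_div_iff₀' hδ] at h2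
    simp only [hF]
    rw [Set.indicator_of_mem (by exact h2), mul_comm]
  · intro n hn
    by_cases hp : n.Prime
    · refine Set.indicator_of_notMem (fun hv' ↦ hn ?_) _
      have h2 : Real.log n ≤ v / δ := (le_div_iff₀' hδ).2 hv'
      have hn0 : (0 : ℝ) < n := by exact_mod_cast hp.pos
      rw [Real.log_le_iff_le_exp hn0] at h2
      exact Finset.mem_Ioc.2 ⟨hp.pos, Nat.le_floor h2⟩
    · simp [hF, hp]

theorem abs_neg_log_one_sub_sub_le {y : ℝ} (hy0 : 0 ≤ y) (hy : y ≤ 1 / 2) :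
    |-Real.log (1 - y) - y| ≤ 2 * y ^ 2 := by
  have h := Real.abs_log_sub_add_sum_range_le (x := y) (by rw [abs_of_nonneg hy0]; linarith) 1
  simp only [Finset.range_one, Finset.sum_singleton, zero_add, pow_one, Nat.cast_zero, div_one,
    abs_of_nonneg hy0] at h
  rw [← abs_neg]
  calc |-(-Real.log (1 - y) - y)| = |y + Real.log (1 - y)| := by ring_nf
    _ ≤ y ^ 2 / (1 - y) := h
    _ ≤ 2 * y ^ 2 := by
      rw [div_le_iff₀ (by linarith)]
      nlinarith [mul_nonneg (sq_nonneg y) (by linarith : 0 ≤ 1 / 2 - y)]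

/-- The contribution of the higher powers of a prime to the logarithm of the Euler product. -/
noncomputable def eulerLogRemainder (s : ℝ) (n : ℕ) : ℝ :=
  if n.Prime then -Real.log (1 - (n : ℝ) ^ (-s)) - (n : ℝ) ^ (-s) else 0

theorem Nat.Prime.rpow_neg_le_inv {p : ℕ} (hp : p.Prime) {s : ℝ} (hs : 1 ≤ s) :
    (p : ℝ) ^ (-s) ≤ (p : ℝ)⁻¹ := by
  rw [← Real.rpow_neg_one]
  exact Real.rpow_le_rpow_of_exponent_le (by exact_mod_cast hp.one_le) (by linarith)

theorem Nat.Prime.inv_le_half {p : ℕ} (hp : p.Prime) : (p : ℝ)⁻¹ ≤ 1 / 2 := by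
  rw [one_div]
  exact inv_anti₀ (by norm_num) (by exact_mod_cast hp.two_le)

theorem abs_eulerLogRemainder_le {s : ℝ} (hs : 1 ≤ s) (n : ℕ) :
    ‖eulerLogRemainder s n‖ ≤ 2 * ((n : ℝ) ^ 2)⁻¹ := by
  unfold eulerLogRemainder
  split_ifs with hn
  · have h1 := hn.rpow_neg_le_inv hs
    have h0 : 0 ≤ (n : ℝ) ^ (-s) := by positivity
    refine (abs_neg_log_one_sub_sub_le h0 (h1.trans hn.inv_le_half)).trans ?_
    rw [← inv_pow]
    gcongr
  · rw [norm_zero]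
    positivity

theorem summable_two_mul_sq_inv : Summable fun n : ℕ ↦ 2 * ((n : ℝ) ^ 2)⁻¹ :=
  (Real.summable_nat_pow_inv.2 one_lt_two).mul_left 2

theorem summable_eulerLogRemainder {s : ℝ} (hs : 1 ≤ s) : Summable (eulerLogRemainder s) :=
  .of_norm_bounded summable_two_mul_sq_inv (abs_eulerLogRemainder_le hs)

theorem tendsto_tsum_eulerLogRemainder :
    Tendsto (fun δ : ℝ ↦ ∑' n, eulerLogRemainder (1 + δ) n) (𝓝[>] 0)
      (𝓝 (∑' n, eulerLogRemainder 1 n)) := by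
  refine tendsto_tsum_of_dominated_convergence summable_two_mul_sq_inv (fun n ↦ ?_) ?_
  · unfold eulerLogRemainder
    by_cases hn : n.Prime
    · simp only [hn, if_true]
      have hn0 : (n : ℝ) ≠ 0 := by exact_mod_cast hn.ne_zero
      have hc : Tendsto (fun δ : ℝ ↦ (n : ℝ) ^ (-(1 + δ))) (𝓝[>] 0) (𝓝 ((n : ℝ) ^ (-(1 : ℝ)))) := by
        have : Continuous fun δ : ℝ ↦ (n : ℝ) ^ (-(1 + δ)) :=
          Real.continuous_const_rpow hn0 |>.comp (by fun_prop)
        simpa using (this.tendsto 0).mono_left nhdsWithin_le_nhds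
      have hne : 1 - (n : ℝ) ^ (-(1 : ℝ)) ≠ 0 := by
        rw [Real.rpow_neg_one]
        linarith [hn.inv_le_half]
      exact ((hc.const_sub 1).log hne).neg.sub hc
    · simp [hn]
  · filter_upwards [self_mem_nhdsWithin] with δ (hδ : 0 < δ) n
    exact abs_eulerLogRemainder_le (by linarith) n

theorem exp_tsum_eq_riemannZeta {s : ℝ} (hs : 1 < s) :
    ((Real.exp (∑' n : ℕ, (if n.Prime then (n : ℝ) ^ (-s) else 0) +
      ∑' n, eulerLogRemainder s n) : ℝ) : ℂ) = riemannZeta s := by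
  rw [← riemannZeta_eulerProduct_exp_log (by simpa using hs), Complex.ofReal_exp]
  congr 1
  rw [← (summable_ite_prime_rpow hs).tsum_add (summable_eulerLogRemainder hs.le),
    Complex.ofReal_tsum]
  set f : ℕ → ℂ := fun n ↦ ((-Real.log (1 - (n : ℝ) ^ (-s)) : ℝ) : ℂ) with hf
  have : ∀ p : Nat.Primes, -Complex.log (1 - (p : ℂ) ^ (-(s : ℂ))) = f p := fun p ↦ by
    have h1 := (p.2.rpow_neg_le_inv hs.le).trans p.2.inv_le_half
    simp only [hf, Complex.ofReal_neg]
    rw [Complex.ofReal_log (by linarith), Complex.ofReal_sub, Complex.ofReal_cpow (by positivity)]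
    simp
  simp only [this]
  rw [show ∑' p : Nat.Primes, f p = ∑' n, Set.indicator {p : ℕ | p.Prime} f n
    from tsum_subtype {p : ℕ | p.Prime} f]
  refine tsum_congr fun n ↦ ?_
  by_cases hn : n.Prime
  · simp [eulerLogRemainder, hn, hf]
  · simp [eulerLogRemainder, hn]

theorem tendsto_tsum_prime_rpow_add_log :
    Tendsto (fun δ : ℝ ↦ ∑' n : ℕ, (if n.Prime then (n : ℝ) ^ (-(1 + δ)) else 0) + Real.log δ)
      (𝓝[>] 0) (𝓝 (-∑' n, eulerLogRemainder 1 n)) := by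
  have hz : Tendsto (fun δ : ℝ ↦ (δ : ℂ) * riemannZeta ((1 + δ : ℝ) : ℂ)) (𝓝[>] 0) (𝓝 1) := by
    have h1 : Tendsto (fun δ : ℝ ↦ ((1 + δ : ℝ) : ℂ)) (𝓝[>] 0) (𝓝[≠] 1) := by
      refine tendsto_nhdsWithin_iff.2 ⟨?_, ?_⟩
      · have : Continuous fun δ : ℝ ↦ ((1 + δ : ℝ) : ℂ) := by fun_prop
        simpa using (this.tendsto 0).mono_left nhdsWithin_le_nhds
      · filter_upwards [self_mem_nhdsWithin] with δ (hδ : 0 < δ)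
        simpa using hδ.ne'
    refine (riemannZeta_residue_one.comp h1).congr fun δ ↦ ?_
    simp [Function.comp]
  set T : ℝ → ℝ := fun δ ↦ ∑' n : ℕ, (if n.Prime then (n : ℝ) ^ (-(1 + δ)) else 0) with hT
  have hr : Tendsto (fun δ : ℝ ↦ δ * Real.exp (T δ + ∑' n, eulerLogRemainder (1 + δ) n))
      (𝓝[>] 0) (𝓝 1) := by
    have := (Complex.continuous_re.tendsto 1).comp hz
    rw [Complex.one_re] at this
    refine this.congr' ?_
    filter_upwards [self_mem_nhdsWithin] with δ (hδ : 0 < δ)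
    rw [Function.comp, ← exp_tsum_eq_riemannZeta (by linarith), ← Complex.ofReal_mul,
      Complex.ofReal_re]
  have hl := hr.log one_ne_zero
  rw [Real.log_one] at hl
  have := hl.sub tendsto_tsum_eulerLogRemainder
  rw [zero_sub] at this
  refine this.congr' ?_
  filter_upwards [self_mem_nhdsWithin] with δ (hδ : 0 < δ)
  rw [Real.log_mul hδ.ne' (Real.exp_ne_zero _), Real.log_exp]
  ring

/-- **Mertens' third theorem**, logarithmic form. -/
theorem tendsto_sum_neg_log_one_sub_prime_inv_sub_log_log :
    Tendsto (fun x : ℝ ↦ ∑ n ∈ Finset.Ioc 0 ⌊x⌋₊,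
      (if n.Prime then -Real.log (1 - (n : ℝ)⁻¹) else 0) - Real.log (Real.log x)) atTop
        (𝓝 Real.eulerMascheroniConstant) := by
  obtain ⟨C, hC⟩ := exists_tendsto_primeInvSum_sub_log_log
  have h1 := tendsto_integral_exp_neg_mul_primeInvSum hC
  have h2 : Tendsto (fun δ : ℝ ↦
      (∫ v in Set.Ioi (0 : ℝ), Real.exp (-v) * primeInvSum (Real.exp (v / δ))) + Real.log δ)
        (𝓝[>] 0) (𝓝 (-∑' n, eulerLogRemainder 1 n)) := by
    refine tendsto_tsum_prime_rpow_add_log.congr' ?_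
    filter_upwards [self_mem_nhdsWithin] with δ (hδ : 0 < δ)
    rw [tsum_prime_rpow_eq_integral hδ]
  have h3 := tendsto_nhds_unique h1 h2
  have h4 : Tendsto (fun x : ℝ ↦ ∑ n ∈ Finset.Ioc 0 ⌊x⌋₊, eulerLogRemainder 1 n) atTop
      (𝓝 (∑' n, eulerLogRemainder 1 n)) := by
    have := ((summable_eulerLogRemainder le_rfl).hasSum.tendsto_sum_nat.comp
      (tendsto_add_atTop_nat 1)).comp (tendsto_nat_floor_atTop (α := ℝ))
    refine this.congr fun x ↦ ?_
    simp only [Function.comp]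
    rw [Finset.sum_range_eq_add_Ico _ (by omega)]
    simp only [eulerLogRemainder, Nat.not_prime_zero, if_false, zero_add]
    exact Finset.sum_congr (by ext; simp; omega) fun _ _ ↦ rfl
  have h5 := hC.add h4
  rw [show C + ∑' n, eulerLogRemainder 1 n = Real.eulerMascheroniConstant by linarith] at h5
  refine h5.congr fun x ↦ ?_
  rw [primeInvSum, sub_add_eq_add_sub, ← Finset.sum_add_distrib]
  congr 1
  refine Finset.sum_congr rfl fun n _ ↦ ?_
  simp only [eulerLogRemainder, Real.rpow_neg_one]
  split_ifs <;> ring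

theorem AddChar.map_finset_sum {A M ι : Type*} [AddCommMonoid A] [CommMonoid M] (ψ : AddChar A M)
    (s : Finset ι) (g : ι → A) : ψ (∑ i ∈ s, g i) = ∏ i ∈ s, ψ (g i) := by
  classical
  induction s using Finset.induction_on with
  | empty => simp
  | insert a s ha ih => rw [Finset.sum_insert ha, Finset.prod_insert ha, ψ.map_add_eq_mul, ih]

theorem ZMod.norm_sum_range_stdAddChar_pow_le {Q : ℕ} [NeZero Q] {k : ZMod Q} (hk : k ≠ 0)
    (N : ℕ) :
    ‖∑ m ∈ Finset.range N, ZMod.stdAddChar k ^ m‖ ≤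
      Q / 2 * ((k.val : ℝ)⁻¹ + ((Q : ℝ) - k.val)⁻¹) := by
  have hQ : (0 : ℝ) < Q := by exact_mod_cast NeZero.pos Q
  have hk0 : (0 : ℝ) < k.val := by
    exact_mod_cast Nat.pos_of_ne_zero ((ZMod.val_ne_zero k).2 hk)
  have hkQ : (0 : ℝ) < Q - k.val := sub_pos.2 (by exact_mod_cast ZMod.val_lt k)
  set t : ℝ := k.val / Q with ht
  have ht0 : 0 < t := div_pos hk0 hQ
  have ht1 : 1 - t = (Q - k.val) / Q := by rw [ht]; field_simp
  have ht1' : 0 < 1 - t := ht1 ▸ div_pos hkQ hQ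
  have hpi := Real.pi_pos
  have hnorm : ‖ZMod.stdAddChar k - 1‖ = 2 * Real.sin (Real.pi * t) := by
    have : ZMod.stdAddChar k = Complex.exp (Complex.I * ((2 * Real.pi * t : ℝ) : ℂ)) := by
      rw [ZMod.stdAddChar_apply, ZMod.toCircle_apply]
      congr 1
      rw [ht]
      push_cast
      ring
    rw [this, Complex.norm_exp_I_mul_ofReal_sub_one, Real.norm_of_nonneg]
    · ring_nf
    · refine mul_nonneg zero_le_two (Real.sin_nonneg_of_nonneg_of_le_pi (by positivity) ?_)
      nlinarith
  have hsin : 2 * min t (1 - t) ≤ Real.sin (Real.pi * t) := by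
    rcases le_total t (1 / 2) with h | h
    · rw [min_eq_left (by linarith)]
      have := Real.mul_le_sin (x := Real.pi * t) (by positivity) (by nlinarith)
      calc 2 * t = 2 / Real.pi * (Real.pi * t) := by field_simp
        _ ≤ _ := this
    · rw [min_eq_right (by linarith)]
      have := Real.mul_le_sin (x := Real.pi * (1 - t)) (by positivity) (by nlinarith)
      calc 2 * (1 - t) = 2 / Real.pi * (Real.pi * (1 - t)) := by field_simp
        _ ≤ _ := this
        _ = _ := by rw [mul_sub, mul_one, Real.sin_pi_sub]
  have hmin : 0 < min t (1 - t) := lt_min ht0 ht1'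
  have hne : ZMod.stdAddChar k ≠ 1 := fun h ↦ by
    rw [h, sub_self, norm_zero] at hnorm
    linarith
  rw [geom_sum_eq hne, norm_div, hnorm]
  have hnum : ‖ZMod.stdAddChar k ^ N - 1‖ ≤ 2 := by
    refine (norm_sub_le _ _).trans ?_
    rw [norm_pow, AddChar.norm_apply, one_pow, norm_one]
    norm_num
  have hinv : (min t (1 - t))⁻¹ ≤ t⁻¹ + (1 - t)⁻¹ := by
    rcases min_choice t (1 - t) with h | h <;> rw [h]
    · exact le_add_of_nonneg_right (by positivity)
    · exact le_add_of_nonneg_left (by positivity)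
  calc ‖ZMod.stdAddChar k ^ N - 1‖ / (2 * Real.sin (Real.pi * t))
      ≤ 2 / (2 * (2 * min t (1 - t))) := by gcongr
    _ = (min t (1 - t))⁻¹ / 2 := by field_simp
    _ ≤ (t⁻¹ + (1 - t)⁻¹) / 2 := by gcongr
    _ = _ := by
      rw [ht1, ht]
      field_simp

theorem sum_sqrt_gcd_div_le {Q : ℕ} (hQ : Q ≠ 0) :
    ∑ k ∈ Finset.Ioo 0 Q, √(k.gcd Q) * (k : ℝ)⁻¹ ≤ Q.divisors.card * (1 + Real.log Q) := by
  have hH : ∀ n ≤ Q, ∑ j ∈ Finset.Icc 1 n, (j : ℝ)⁻¹ ≤ 1 + Real.log Q := fun n hn ↦ by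
    have h := harmonic_le_one_add_log Q
    rw [harmonic_eq_sum_Icc] at h
    push_cast at h
    exact (Finset.sum_le_sum_of_subset_of_nonneg (Finset.Icc_subset_Icc_right hn)
      fun i _ _ ↦ by positivity).trans h
  calc ∑ k ∈ Finset.Ioo 0 Q, √(k.gcd Q) * (k : ℝ)⁻¹
      ≤ ∑ k ∈ Finset.Ioo 0 Q, ∑ d ∈ Q.divisors, if d ∣ k then √d * (k : ℝ)⁻¹ else 0 := by
        refine Finset.sum_le_sum fun k _ ↦ ?_
        refine le_trans ?_ (Finset.single_le_sum (a := k.gcd Q) (fun d _ ↦ ?_)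
          (Nat.mem_divisors.2 ⟨Nat.gcd_dvd_right _ _, hQ⟩))
        · rw [if_pos (Nat.gcd_dvd_left _ _)]
        · split_ifs <;> positivity
    _ = ∑ d ∈ Q.divisors, ∑ k ∈ Finset.Ioo 0 Q, if d ∣ k then √d * (k : ℝ)⁻¹ else 0 :=
        Finset.sum_comm
    _ ≤ ∑ d ∈ Q.divisors, (1 + Real.log Q) := by
        refine Finset.sum_le_sum fun d hd ↦ ?_
        have hd0 : 0 < d := Nat.pos_of_mem_divisors hd
        refine le_trans ?_ (hH (Q / d) (Nat.div_le_self _ _))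
        rw [← Finset.sum_filter]
        refine (Finset.sum_le_sum (g := fun k : ℕ ↦ (((k / d : ℕ) : ℝ))⁻¹) fun k hk ↦ ?_).trans ?_
        · obtain ⟨hk0, j, rfl⟩ := Finset.mem_filter.1 hk
          have hj : 0 < j := Nat.pos_of_mul_pos_left (Finset.mem_Ioo.1 hk0).1
          rw [Nat.mul_div_cancel_left j hd0, Nat.cast_mul, mul_inv, ← mul_assoc]
          have hd1 : (1 : ℝ) ≤ d := by exact_mod_cast hd0
          have : √(d : ℝ) * (d : ℝ)⁻¹ ≤ 1 := by
            rw [← div_eq_mul_inv, div_le_one (by linarith), Real.sqrt_le_left (by linarith)]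
            nlinarith
          exact mul_le_of_le_one_left (by positivity) this
        · rw [← Finset.sum_image (f := fun j : ℕ ↦ (j : ℝ)⁻¹) (g := fun k : ℕ ↦ k / d)]
          · refine Finset.sum_le_sum_of_subset_of_nonneg ?_ fun i _ _ ↦ by positivity
            intro j hj
            obtain ⟨k, hk, rfl⟩ := Finset.mem_image.1 hj
            obtain ⟨hk0, j, rfl⟩ := Finset.mem_filter.1 hk
            obtain ⟨h1, h2⟩ := Finset.mem_Ioo.1 hk0
            simp only [Nat.mul_div_cancel_left j hd0, Finset.mem_Icc]
            exact ⟨Nat.pos_of_mul_pos_left h1, (Nat.le_div_iff_mul_le hd0).2 (by linarith)⟩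
          · intro a ha b hb hab
            simp only [Finset.coe_filter, Set.mem_ofPred_eq] at ha hb
            exact (Nat.div_left_inj ha.2 hb.2).1 hab
    _ = _ := by rw [Finset.sum_const, nsmul_eq_mul]

section CharacterSums

variable {ι : Type*} {p : ι → ℕ} [∀ i, Fact (p i).Prime]

theorem pairwise_coprime_of_injective (hp : Function.Injective p) :
    Pairwise (Function.onFun Nat.Coprime p) := fun i _ hij ↦
  (Nat.coprime_primes (Fact.out : (p i).Prime) Fact.out).2 (hp.ne hij)

variable [Fintype ι]

theorem card_divisors_prod_eq (hp : Function.Injective p) :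
    (∏ i, p i).divisors.card = 2 ^ Fintype.card ι := by
  classical
  have : ∀ s : Finset ι, (∏ i ∈ s, p i).divisors.card = 2 ^ s.card := fun s ↦ by
    induction s using Finset.induction_on with
    | empty => simp
    | insert a s ha ih =>
      rw [Finset.prod_insert ha, Nat.Coprime.card_divisors_mul, ih, Finset.card_insert_of_notMem ha,
        (Fact.out : (p a).Prime).divisors, Finset.card_pair (Fact.out : (p a).Prime).one_lt.ne,
        pow_succ']
      refine Nat.Coprime.prod_right fun i hi ↦ pairwise_coprime_of_injective hp ?_
      rintro rfl
      exact ha hi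
  simpa using this Finset.univ

theorem exists_ringEquiv_apply_eq_cast {Q : ℕ} [NeZero Q] (hQ : Q = ∏ i, p i)
    (hp : Function.Injective p) :
    ∃ e : ZMod Q ≃+* ((i : ι) → ZMod (p i)), ∀ a i, e a i = a.cast := by
  refine ⟨(ZMod.ringEquivCongr hQ).trans
    (ZMod.prodEquivPi p (pairwise_coprime_of_injective hp)), fun a i ↦ ?_⟩
  generalize (ZMod.ringEquivCongr hQ).trans
    (ZMod.prodEquivPi p (pairwise_coprime_of_injective hp)) = e
  have := congrFun (map_natCast e a.val) i
  rw [ZMod.natCast_zmod_val] at this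
  rw [this, Pi.natCast_apply, ZMod.natCast_val]

theorem sum_prod_cast_eq_prod_sum {Q : ℕ} [NeZero Q] (hQ : Q = ∏ i, p i)
    (hp : Function.Injective p) (h : ∀ i, ZMod (p i) → ℂ) :
    ∑ a : ZMod Q, ∏ i, h i (a.cast : ZMod (p i)) = ∏ i, ∑ a, h i a := by
  classical
  obtain ⟨e, he⟩ := exists_ringEquiv_apply_eq_cast hQ hp
  rw [Finset.prod_univ_sum, Fintype.piFinset_univ, ← e.toEquiv.sum_comp]
  exact Finset.sum_congr rfl fun a _ ↦ Finset.prod_congr rfl fun i _ ↦ by rw [← he]; rfl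

theorem norm_sum_prod_mul_stdAddChar_le {Q : ℕ} [NeZero Q] (hQ : Q = ∏ i, p i)
    (hp : Function.Injective p)
    (h : ∀ i, ZMod (p i) → ℂ) (h1 : ∀ i a, ‖h i a‖ ≤ 1)
    (h2 : ∀ i (ψ : AddChar (ZMod (p i)) ℂ), ψ ≠ 1 → ‖∑ a, h i a * ψ a‖ ≤ √(p i))
    (k : ZMod Q) :
    ‖∑ a : ZMod Q, (∏ i, h i (a.cast : ZMod (p i))) * ZMod.stdAddChar (k * a)‖ ≤
      √Q * √(k.val.gcd Q) := by
  classical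
  obtain ⟨e, he⟩ := exists_ringEquiv_apply_eq_cast hQ hp
  set ψ : AddChar (ZMod Q) ℂ := ZMod.stdAddChar.mulShift k
  set φ : ∀ i, AddChar (ZMod (p i)) ℂ := fun i ↦
    ψ.compAddMonoidHom ((e.symm.toAddEquiv.toAddMonoidHom).comp
      (AddMonoidHom.single (fun i ↦ ZMod (p i)) i))
  have hφ : ∀ i a, φ i a = ψ (e.symm (Pi.single i a)) := fun i a ↦ rfl
  have hfactor : ∑ a : ZMod Q, (∏ i, h i (a.cast : ZMod (p i))) * ZMod.stdAddChar (k * a) =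
      ∏ i, ∑ a, h i a * φ i a := by
    rw [Finset.prod_univ_sum, Fintype.piFinset_univ, ← e.toEquiv.sum_comp]
    refine Finset.sum_congr rfl fun a _ ↦ ?_
    rw [Finset.prod_mul_distrib]
    congr 1
    · exact Finset.prod_congr rfl fun i _ ↦ by rw [← he]; rfl
    · simp only [hφ]
      rw [← AddChar.map_finset_sum, ← map_sum, Finset.univ_sum_single]
      simp [ψ, AddChar.mulShift_apply]
  have htriv : ∀ i, φ i = 1 → p i ∣ k.val := fun i hi ↦ by
    have hz : k * e.symm (Pi.single i 1) = 0 := by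
      by_contra hne
      refine ZMod.isPrimitive_stdAddChar Q hne (DFunLike.ext _ _ fun b ↦ ?_)
      have := DFunLike.congr_fun hi (e b i)
      rw [hφ, AddChar.mulShift_apply, AddChar.one_apply] at this
      rw [AddChar.mulShift_apply, mul_assoc, AddChar.one_apply, ← this]
      congr 2
      apply e.injective
      rw [map_mul, e.apply_symm_apply, e.apply_symm_apply, ← Pi.single_mul_left, one_mul]
    have := congrFun (congrArg e hz) i
    rw [map_mul, e.apply_symm_apply, map_zero, Pi.mul_apply, Pi.single_eq_same, mul_one, he] at this
    rw [← ZMod.natCast_eq_zero_iff]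
    rw [ZMod.natCast_val]
    exact this
  have hlocal : ∀ i, ‖∑ a, h i a * φ i a‖ ≤ √(p i) * √(if p i ∣ k.val then p i else 1 : ℕ) := by
    intro i
    by_cases hi : φ i = 1
    · rw [if_pos (htriv i hi), Real.mul_self_sqrt (by positivity)]
      calc ‖∑ a, h i a * φ i a‖ ≤ ∑ a : ZMod (p i), (1 : ℝ) := by
            refine norm_sum_le_of_le _ fun a _ ↦ ?_
            rw [norm_mul, AddChar.norm_apply, mul_one]
            exact h1 i a
        _ = p i := by simp [ZMod.card]
    · refine (h2 i (φ i) hi).trans (le_mul_of_one_le_right (by positivity) ?_)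
      rw [Real.one_le_sqrt]
      split_ifs
      · exact_mod_cast (Fact.out : (p i).Prime).one_le
      · simp
  rw [hfactor, norm_prod]
  calc ∏ i, ‖∑ a, h i a * φ i a‖
      ≤ ∏ i, (√(p i) * √(if p i ∣ k.val then p i else 1 : ℕ)) :=
        Finset.prod_le_prod (fun i _ ↦ norm_nonneg _) fun i _ ↦ hlocal i
    _ = √Q * √(∏ i, (if p i ∣ k.val then p i else 1) : ℕ) := by
        have hsqrt : √(Q : ℝ) = ∏ i, √(p i) := by
          rw [← Real.sqrt_prod _ fun i _ ↦ by positivity, ← Nat.cast_prod, ← hQ]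
        rw [Finset.prod_mul_distrib, hsqrt, Nat.cast_prod,
          Real.sqrt_prod _ fun i _ ↦ by positivity]
    _ ≤ _ := by
        gcongr
        refine Nat.le_of_dvd (Nat.gcd_pos_of_pos_right _ (NeZero.pos Q)) (Nat.dvd_gcd ?_ ?_)
        · rw [← Finset.prod_filter]
          refine Finset.prod_dvd_of_isRelPrime (fun i _ j _ hij ↦ ?_) fun i hi ↦ ?_
          · exact Nat.coprime_iff_isRelPrime.1 (pairwise_coprime_of_injective hp hij)
          · exact (Finset.mem_filter.1 hi).2
        · refine (Finset.prod_dvd_prod_of_dvd _ _ fun i _ ↦ ?_).trans hQ.symm.dvd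
          split_ifs
          · exact dvd_rfl
          · exact one_dvd _

/-- A Pólya–Vinogradov type estimate for products of functions with square-root cancellation. -/
theorem norm_sum_range_prod_sub_le (hp : Function.Injective p)
    (h : ∀ i, ZMod (p i) → ℂ) (h1 : ∀ i a, ‖h i a‖ ≤ 1)
    (h2 : ∀ i (ψ : AddChar (ZMod (p i)) ℂ), ψ ≠ 1 → ‖∑ a, h i a * ψ a‖ ≤ √(p i)) (N : ℕ) :
    ‖∑ m ∈ Finset.range N, ∏ i, h i (m : ZMod (p i)) -
        N / (∏ i, p i : ℕ) * ∏ i, ∑ a, h i a‖ ≤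
      √(∏ i, p i : ℕ) * (2 ^ Fintype.card ι * (1 + Real.log (∏ i, p i : ℕ))) := by
  obtain ⟨Q, hQ⟩ : ∃ Q, Q = ∏ i, p i := ⟨_, rfl⟩
  rw [← hQ]
  have hQ0 : Q ≠ 0 := by
    rw [hQ]
    exact Finset.prod_ne_zero_iff.2 fun i _ ↦ (Fact.out : (p i).Prime).ne_zero
  have : NeZero Q := ⟨hQ0⟩
  have hQr : (0 : ℝ) < Q := by positivity
  have hQc : (Q : ℂ) ≠ 0 := by exact_mod_cast hQ0
  set g : ZMod Q → ℂ := fun a ↦ ∏ i, h i (a.cast : ZMod (p i)) with hg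
  set G : ZMod Q → ℂ := fun k ↦ ∑ a, g a * ZMod.stdAddChar (k * a) with hG
  have hgcast : ∀ m : ℕ, ∏ i, h i (m : ZMod (p i)) = g m := fun m ↦ by
    refine Finset.prod_congr rfl fun i _ ↦ ?_
    rw [ZMod.cast_natCast (hQ ▸ Finset.dvd_prod_of_mem p (Finset.mem_univ i))]
  have hG0 : G 0 = ∏ i, ∑ a, h i a := by
    rw [← sum_prod_cast_eq_prod_sum hQ hp]
    exact Finset.sum_congr rfl fun a _ ↦ by rw [zero_mul, AddChar.map_zero_eq_one, mul_one]
  have hinv : ∀ b, g b = (Q : ℂ)⁻¹ * ∑ k, G k * ZMod.stdAddChar (-k * b) := fun b ↦ by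
    have : ∑ k, G k * ZMod.stdAddChar (-k * b) =
        ∑ a, g a * ∑ k : ZMod Q, ZMod.stdAddChar (k * (a - b)) := by
      simp only [hG, Finset.sum_mul, Finset.mul_sum]
      rw [Finset.sum_comm]
      refine Finset.sum_congr rfl fun a _ ↦ Finset.sum_congr rfl fun k _ ↦ ?_
      rw [mul_assoc, ← AddChar.map_add_eq_mul]
      ring_nf
    simp only [this, AddChar.sum_mulShift _ (ZMod.isPrimitive_stdAddChar Q), sub_eq_zero,
      ZMod.card, Nat.cast_ite, Nat.cast_zero, mul_ite, mul_zero, Finset.sum_ite_eq',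
      Finset.mem_univ, if_true]
    field_simp
  have hsum : ∑ m ∈ Finset.range N, ∏ i, h i (m : ZMod (p i)) =
      (Q : ℂ)⁻¹ * ∑ k, G k * ∑ m ∈ Finset.range N, ZMod.stdAddChar (-k) ^ m := by
    simp only [hgcast, hinv]
    rw [← Finset.mul_sum, Finset.sum_comm]
    congr 1
    refine Finset.sum_congr rfl fun k _ ↦ ?_
    rw [Finset.mul_sum]
    refine Finset.sum_congr rfl fun m _ ↦ ?_
    rw [← AddChar.map_nsmul_eq_pow, nsmul_eq_mul, mul_comm (-k)]
  have hmain : ∑ m ∈ Finset.range N, ∏ i, h i (m : ZMod (p i)) - N / Q * ∏ i, ∑ a, h i a =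
      (Q : ℂ)⁻¹ * ∑ k ∈ Finset.univ.erase 0,
        G k * ∑ m ∈ Finset.range N, ZMod.stdAddChar (-k) ^ m := by
    rw [hsum, ← Finset.add_sum_erase _ _ (Finset.mem_univ (0 : ZMod Q)), hG0]
    simp only [neg_zero, AddChar.map_zero_eq_one, one_pow, Finset.sum_const, Finset.card_range,
      nsmul_eq_mul, mul_one]
    ring
  have hterm : ∀ k ∈ Finset.univ.erase (0 : ZMod Q),
      ‖G k * ∑ m ∈ Finset.range N, ZMod.stdAddChar (-k) ^ m‖ ≤
        Q * √Q / 2 * (√(k.val.gcd Q) * ((k.val : ℝ)⁻¹ + ((Q : ℝ) - k.val)⁻¹)) := fun k hk ↦ by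
    have hk0 : k ≠ 0 := Finset.ne_of_mem_erase hk
    have hb := ZMod.norm_sum_range_stdAddChar_pow_le (neg_ne_zero.2 hk0) N
    rw [ZMod.neg_val, if_neg hk0, Nat.cast_sub (ZMod.val_le k), sub_sub_cancel] at hb
    rw [norm_mul]
    calc _ ≤ (√Q * √(k.val.gcd Q)) * (Q / 2 * (((Q : ℝ) - k.val)⁻¹ + (k.val : ℝ)⁻¹)) :=
          mul_le_mul (norm_sum_prod_mul_stdAddChar_le hQ hp h h1 h2 k) hb (norm_nonneg _)
            (by positivity)
      _ = _ := by ring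
  have hrange : ∑ k ∈ Finset.univ.erase (0 : ZMod Q),
      √(k.val.gcd Q) * ((k.val : ℝ)⁻¹ + ((Q : ℝ) - k.val)⁻¹) =
        ∑ j ∈ Finset.Ioo 0 Q, √(j.gcd Q) * ((j : ℝ)⁻¹ + ((Q : ℝ) - j)⁻¹) := by
    refine Finset.sum_nbij' (fun k ↦ k.val) (fun j ↦ (j : ZMod Q)) ?_ ?_ ?_ ?_ ?_
    · intro k hk
      exact Finset.mem_Ioo.2 ⟨Nat.pos_of_ne_zero ((ZMod.val_ne_zero k).2
        (Finset.ne_of_mem_erase hk)), ZMod.val_lt k⟩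
    · intro j hj
      obtain ⟨h0, hj⟩ := Finset.mem_Ioo.1 hj
      refine Finset.mem_erase.2 ⟨fun h ↦ ?_, Finset.mem_univ _⟩
      exact Nat.not_dvd_of_pos_of_lt h0 hj ((ZMod.natCast_eq_zero_iff _ _).1 h)
    · simp
    · intro j hj
      exact ZMod.val_cast_of_lt (Finset.mem_Ioo.1 hj).2
    · simp
  have hsymm : ∑ j ∈ Finset.Ioo 0 Q, √(j.gcd Q) * ((Q : ℝ) - j)⁻¹ =
      ∑ j ∈ Finset.Ioo 0 Q, √(j.gcd Q) * (j : ℝ)⁻¹ := by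
    refine Finset.sum_nbij' (fun j ↦ Q - j) (fun j ↦ Q - j) ?_ ?_ ?_ ?_ ?_ <;>
      intro j hj <;> obtain ⟨h0, hj⟩ := Finset.mem_Ioo.1 hj
    · exact Finset.mem_Ioo.2 (by omega)
    · exact Finset.mem_Ioo.2 (by omega)
    · omega
    · omega
    · rw [Nat.cast_sub hj.le, Nat.gcd_comm (Q - j), Nat.gcd_self_sub_right hj.le, Nat.gcd_comm]
  have hgcd := sum_sqrt_gcd_div_le hQ0
  rw [hQ, card_divisors_prod_eq hp, ← hQ, Nat.cast_pow, Nat.cast_two] at hgcd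
  rw [hmain, norm_mul, norm_inv, Complex.norm_natCast]
  calc (Q : ℝ)⁻¹ * ‖∑ k ∈ Finset.univ.erase (0 : ZMod Q),
        G k * ∑ m ∈ Finset.range N, ZMod.stdAddChar (-k) ^ m‖
      ≤ (Q : ℝ)⁻¹ * ∑ k ∈ Finset.univ.erase (0 : ZMod Q),
        Q * √Q / 2 * (√(k.val.gcd Q) * ((k.val : ℝ)⁻¹ + ((Q : ℝ) - k.val)⁻¹)) := by
        gcongr
        exact norm_sum_le_of_le _ hterm
    _ = √Q * ∑ j ∈ Finset.Ioo 0 Q, √(j.gcd Q) * (j : ℝ)⁻¹ := by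
        rw [← Finset.mul_sum, hrange]
        simp only [mul_add, Finset.sum_add_distrib, hsymm]
        field_simp
        ring
    _ ≤ _ := by gcongr

end CharacterSums

section QuadraticResidues

variable {F : Type*} [Field F] [Fintype F] [DecidableEq F]

/-- The indicator function of the nonzero squares of a finite field. -/
noncomputable def residueIndicator (a : F) : ℂ := if quadraticChar F a = 1 then 1 else 0

theorem residueIndicator_eq (a : F) :
    residueIndicator a = (1 - (if a = 0 then 1 else 0) + (quadraticChar F a : ℂ)) / 2 := by
  rw [residueIndicator]
  by_cases ha : a = 0
  · simp [ha]
  · rcases quadraticChar_dichotomy ha with h | h <;> simp [h, ha]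

theorem norm_residueIndicator_le_one (a : F) : ‖residueIndicator a‖ ≤ 1 := by
  rw [residueIndicator]
  split_ifs <;> simp

theorem sum_residueIndicator (hF : ringChar F ≠ 2) :
    ∑ a : F, residueIndicator a = ((Fintype.card F : ℂ) - 1) / 2 := by
  have h := congrArg (Int.cast : ℤ → ℂ) (quadraticChar_sum_zero hF)
  push_cast at h
  simp only [residueIndicator_eq]
  rw [← Finset.sum_div, Finset.sum_add_distrib, Finset.sum_sub_distrib, h]
  simp

theorem norm_gaussSum_quadraticChar (hF : ringChar F ≠ 2) {ψ : AddChar F ℂ} (hψ : ψ ≠ 1) :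
    ‖∑ a, (quadraticChar F a : ℂ) * ψ a‖ = √(Fintype.card F) := by
  have hinj : Function.Injective (Int.castRingHom ℂ) := Int.cast_injective
  have h := gaussSum_sq (χ := (quadraticChar F).ringHomComp (Int.castRingHom ℂ))
    ((MulChar.ringHomComp_ne_one_iff hinj).2 (quadraticChar_ne_one hF))
    ((quadraticChar_isQuadratic F).comp _) (AddChar.IsPrimitive.of_ne_one hψ)
  have h' := congrArg norm h
  rw [norm_pow, norm_mul] at h'
  have h1 : ‖((quadraticChar F).ringHomComp (Int.castRingHom ℂ)) (-1)‖ = 1 := by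
    rcases quadraticChar_dichotomy (neg_ne_zero.2 (one_ne_zero (α := F))) with h | h <;>
      simp [MulChar.ringHomComp_apply, h]
  rw [h1, one_mul, Complex.norm_natCast] at h'
  rw [← h', Real.sqrt_sq (norm_nonneg _)]
  rfl

theorem norm_sum_residueIndicator_mul_addChar_le (hF : ringChar F ≠ 2) {ψ : AddChar F ℂ}
    (hψ : ψ ≠ 1) : ‖∑ a, residueIndicator a * ψ a‖ ≤ √(Fintype.card F) := by
  have hsum : ∑ a, residueIndicator a * ψ a =
      (-1 + ∑ a, (quadraticChar F a : ℂ) * ψ a) / 2 := by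
    simp only [residueIndicator_eq, div_mul_eq_mul_div, add_mul, sub_mul, one_mul, ite_mul,
      zero_mul]
    rw [← Finset.sum_div, Finset.sum_add_distrib, Finset.sum_sub_distrib,
      AddChar.sum_eq_zero_of_ne_one hψ]
    simp
  have h1 : 1 ≤ √(Fintype.card F : ℝ) := by
    rw [Real.one_le_sqrt]
    exact_mod_cast Fintype.card_pos
  have h2 := norm_add_le (-1 : ℂ) (∑ a, (quadraticChar F a : ℂ) * ψ a)
  rw [norm_gaussSum_quadraticChar hF hψ, norm_neg, norm_one] at h2
  rw [hsum, norm_div, Complex.norm_two]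
  linarith

theorem sum_residueIndicator_one_add_mul (hF : ringChar F ≠ 2) {c : F} (hc : c ≠ 0) :
    ∑ a : F, residueIndicator (1 + c * a) = ((Fintype.card F : ℂ) - 1) / 2 := by
  rw [← sum_residueIndicator hF]
  exact ((Equiv.mulLeft₀ c hc).trans (Equiv.addLeft 1)).sum_comp residueIndicator

theorem norm_sum_residueIndicator_one_add_mul_addChar_le (hF : ringChar F ≠ 2) {c : F}
    (hc : c ≠ 0) {ψ : AddChar F ℂ} (hψ : ψ ≠ 1) :
    ‖∑ a, residueIndicator (1 + c * a) * ψ a‖ ≤ √(Fintype.card F) := by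
  have hφ : ψ.mulShift c⁻¹ ≠ 1 := AddChar.IsPrimitive.of_ne_one hψ (inv_ne_zero hc)
  have hsum : ∑ a, residueIndicator (1 + c * a) * ψ a =
      ψ (-c⁻¹) * ∑ b, residueIndicator b * ψ.mulShift c⁻¹ b := by
    rw [← ((Equiv.mulLeft₀ c hc).trans (Equiv.addLeft 1)).sum_comp
      fun b ↦ residueIndicator b * ψ.mulShift c⁻¹ b, Finset.mul_sum]
    refine Finset.sum_congr rfl fun a _ ↦ ?_
    have : ψ a = ψ (-c⁻¹) * ψ (c⁻¹ * (1 + c * a)) := by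
      rw [← AddChar.map_add_eq_mul, mul_add, inv_mul_cancel_left₀ hc, mul_one,
        neg_add_cancel_left]
    rw [this]
    simp only [AddChar.mulShift_apply, Equiv.trans_apply, Equiv.mulLeft₀_apply,
      Equiv.coe_addLeft]
    ring
  rw [hsum, norm_mul, AddChar.norm_apply, one_mul]
  exact norm_sum_residueIndicator_mul_addChar_le hF hφ

end QuadraticResidues

theorem norm_sum_range_prod_residueIndicator_sub_le {ι : Type*} [Fintype ι] {p : ι → ℕ}
    [∀ i, Fact (p i).Prime] (hp : Function.Injective p) (hp2 : ∀ i, p i ≠ 2) (N : ℕ) :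
    ‖∑ m ∈ Finset.range N, ∏ i, residueIndicator (1 + 8 * m : ZMod (p i)) -
        N / (∏ i, p i : ℕ) * ∏ i, ((p i : ℂ) - 1) / 2‖ ≤
      √(∏ i, p i : ℕ) * (2 ^ Fintype.card ι * (1 + Real.log (∏ i, p i : ℕ))) := by
  have hchar : ∀ i, ringChar (ZMod (p i)) ≠ 2 := fun i ↦ by
    rw [ZMod.ringChar_zmod_n]
    exact hp2 i
  have h8 : ∀ i, (8 : ZMod (p i)) ≠ 0 := fun i h ↦ by
    have h' : ((2 ^ 3 : ℕ) : ZMod (p i)) = 0 := by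
      push_cast
      linear_combination h
    rw [ZMod.natCast_eq_zero_iff] at h'
    exact hp2 i ((Nat.prime_dvd_prime_iff_eq Fact.out Nat.prime_two).1
      ((Fact.out : (p i).Prime).dvd_of_dvd_pow h'))
  have := norm_sum_range_prod_sub_le hp (fun i a ↦ residueIndicator (1 + 8 * a))
    (fun i a ↦ norm_residueIndicator_le_one _) (fun i ψ hψ ↦ by
      have := norm_sum_residueIndicator_one_add_mul_addChar_le (hchar i) (h8 i) hψ
      rwa [ZMod.card] at this) N
  simpa only [sum_residueIndicator_one_add_mul (hchar _) (h8 _), ZMod.card] using this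

theorem mem_primesUpTo {x : ℝ} {p : ℕ} : p ∈ primesUpTo x ↔ p.Prime ∧ (p : ℝ) ≤ x := by
  rw [primesUpTo, Finset.mem_filter, Finset.mem_Iic, and_comm]
  exact and_congr_right fun hp ↦ Nat.le_floor_iff' hp.ne_zero

theorem Mx_pos (x : ℝ) : 0 < Mx x :=
  Finset.prod_pos fun _ hp ↦ (mem_primesUpTo.1 hp).1.pos

/-- The set of `m < N` such that `1 + 8 * m` is a nonzero square modulo all odd primes `p ≤ x`. -/
noncomputable def residueSet (x : ℝ) (N : ℕ) : Finset ℕ :=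
  (Finset.range N).filter fun m ↦ ∀ p ∈ (primesUpTo x).erase 2, legendre p ((1 + 8 * m : ℕ) : ℤ) = 1

theorem abs_card_residueSet_sub_le (x : ℝ) (N : ℕ) :
    |((residueSet x N).card : ℝ) - N * ∏ p ∈ (primesUpTo x).erase 2, (1 - (p : ℝ)⁻¹) / 2| ≤
      √(Mx x) * (2 ^ piX x * (1 + Real.log (Mx x))) := by
  set P := (primesUpTo x).erase 2 with hP
  have hprime : ∀ i : P, (i : ℕ).Prime := fun i ↦
    (mem_primesUpTo.1 (Finset.mem_of_mem_erase i.2)).1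
  have : ∀ i : P, Fact (i : ℕ).Prime := fun i ↦ ⟨hprime i⟩
  have h := norm_sum_range_prod_residueIndicator_sub_le (p := fun i : P ↦ (i : ℕ))
    Subtype.val_injective (fun i ↦ Finset.ne_of_mem_erase i.2) N
  have hprod : ∏ i : P, (i : ℕ) = ∏ p ∈ P, p := Finset.prod_coe_sort P fun p ↦ p
  have hle : ∏ p ∈ P, p ≤ Mx x :=
    Finset.prod_le_prod_of_subset_of_one_le' (Finset.erase_subset _ _) fun p hp _ ↦
      (mem_primesUpTo.1 hp).1.one_le
  have hpos : 0 < ∏ p ∈ P, p := Finset.prod_pos fun p hp ↦ (hprime ⟨p, hp⟩).pos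
  have hcard : Fintype.card P ≤ piX x := by
    rw [Fintype.card_coe]
    exact Finset.card_le_card (Finset.erase_subset _ _)
  have hcount : ∑ m ∈ Finset.range N, ∏ i : P, residueIndicator (1 + 8 * m : ZMod (i : ℕ)) =
      ((residueSet x N).card : ℂ) := by
    rw [residueSet, Finset.card_filter, Nat.cast_sum]
    refine Finset.sum_congr rfl fun m _ ↦ ?_
    have hiff : ∀ i : P, quadraticChar (ZMod (i : ℕ)) (1 + 8 * m : ZMod (i : ℕ)) = 1 ↔
        legendre i ((1 + 8 * m : ℕ) : ℤ) = 1 := fun i ↦ by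
      rw [legendre, dif_pos (hprime i), legendreSym]
      push_cast
      rfl
    simp only [residueIndicator, hiff]
    rw [Finset.prod_ite_zero]
    simp only [Finset.mem_univ, forall_const, Subtype.forall, Finset.prod_const_one,
      Nat.cast_ite, Nat.cast_one, Nat.cast_zero, P]
  have hmain : (N : ℂ) / (∏ i : P, (i : ℕ) : ℕ) * ∏ i : P, (((i : ℕ) : ℂ) - 1) / 2 =
      ((N * ∏ p ∈ P, (1 - (p : ℝ)⁻¹) / 2 : ℝ) : ℂ) := by
    rw [← Finset.prod_coe_sort P fun p ↦ (1 - (p : ℝ)⁻¹) / 2]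
    push_cast
    rw [div_mul_eq_mul_div, mul_div_assoc, ← Finset.prod_div_distrib]
    congr 1
    refine Finset.prod_congr rfl fun i _ ↦ ?_
    have : ((i : ℕ) : ℂ) ≠ 0 := by exact_mod_cast (hprime i).ne_zero
    field_simp
  rw [hcount, hmain, hprod, ← Complex.ofReal_natCast, ← Complex.ofReal_sub, Complex.norm_real,
    Real.norm_eq_abs] at h
  refine h.trans ?_
  have h1 : (1 : ℝ) ≤ (∏ p ∈ P, p : ℕ) := by exact_mod_cast hpos
  have hlog := Real.log_nonneg h1
  have h2 : ((∏ p ∈ P, p : ℕ) : ℝ) ≤ Mx x := by exact_mod_cast hle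
  gcongr
  norm_num

theorem card_filter_isSquare_one_add_le (T : Finset ℕ) (M : ℕ)
    (hT : ∀ m ∈ T, 1 + 8 * m ≤ M) :
    ((T.filter fun m ↦ IsSquare (1 + 8 * m)).card : ℝ) ≤ √M := by
  refine le_trans ?_ (Real.nat_sqrt_le_real_sqrt (a := M))
  have : (T.filter fun m ↦ IsSquare (1 + 8 * m)).card ≤ (Finset.Icc 1 M.sqrt).card := by
    refine Finset.card_le_card_of_injOn (fun m ↦ (1 + 8 * m).sqrt) ?_ ?_
    · intro m hm
      have hm := (Finset.mem_filter.1 hm).1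
      refine Finset.mem_coe.2 (Finset.mem_Icc.2 ⟨Nat.sqrt_pos.2 (by omega), ?_⟩)
      exact Nat.sqrt_le_sqrt (hT m hm)
    · intro a ha b hb hab
      obtain ⟨r, hr⟩ := (Finset.mem_filter.1 ha).2
      obtain ⟨s, hs⟩ := (Finset.mem_filter.1 hb).2
      simp only [hr, hs, Nat.sqrt_eq] at hab
      subst hab
      omega
  rw [Nat.card_Icc, Nat.add_sub_cancel] at this
  exact_mod_cast this

theorem abs_pseudosquaresIn_sub_card_residueSet_le (x : ℝ) :
    |(pseudosquaresIn x 0 (Mx x) : ℝ) - (residueSet x ((Mx x + 7) / 8)).card| ≤ √(Mx x) := by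
  set T := residueSet x ((Mx x + 7) / 8) with hT
  have hTmem : ∀ m, m ∈ T ↔ 1 + 8 * m ≤ Mx x ∧
      ∀ p ∈ (primesUpTo x).erase 2, legendre p ((1 + 8 * m : ℕ) : ℤ) = 1 := fun m ↦ by
    rw [hT, residueSet, Finset.mem_filter, Finset.mem_range]
    refine and_congr_left fun _ ↦ ?_
    omega
  have hset : {n : ℕ | IsPseudosquare x n ∧ (0 : ℝ) < n ∧ (n : ℝ) ≤ 0 + Mx x} =
      ((T.filter fun m ↦ ¬ IsSquare (1 + 8 * m)).image fun m ↦ 1 + 8 * m : Finset ℕ) := by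
    ext n
    simp only [Set.mem_ofPred_eq, Finset.coe_image, Set.mem_image, Finset.coe_filter, hTmem,
      zero_add, Nat.cast_le, Finset.mem_erase, mem_primesUpTo, IsPseudosquare]
    constructor
    · rintro ⟨⟨-, hsq, h8, hleg⟩, -, hle⟩
      obtain ⟨m, rfl⟩ : ∃ m, n = 1 + 8 * m := ⟨n / 8, by omega⟩
      exact ⟨m, ⟨⟨hle, fun p hp ↦ hleg p hp.2.1 hp.1 hp.2.2⟩, hsq⟩, rfl⟩
    · rintro ⟨m, ⟨⟨hle, hleg⟩, hsq⟩, rfl⟩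
      exact ⟨⟨by omega, hsq, by omega, fun p hp hp2 hpx ↦ hleg p ⟨hp2, hp, hpx⟩⟩,
        by positivity, hle⟩
  have hcount : pseudosquaresIn x 0 (Mx x) = (T.filter fun m ↦ ¬ IsSquare (1 + 8 * m)).card := by
    rw [pseudosquaresIn, hset, Set.ncard_coe_finset, Finset.card_image_of_injective]
    intro a b hab
    simpa using hab
  have hsplit := Finset.card_filter_add_card_filter_not (s := T) fun m ↦ IsSquare (1 + 8 * m)
  have hsq := card_filter_isSquare_one_add_le T (Mx x) fun m hm ↦ ((hTmem m).1 hm).1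
  rw [hcount, ← hsplit, Nat.cast_add, sub_add_cancel_right, abs_neg, Nat.abs_cast]
  exact hsq

theorem prod_erase_two_eq {x : ℝ} (hx : 2 ≤ x) :
    ∏ p ∈ (primesUpTo x).erase 2, (1 - (p : ℝ)⁻¹) / 2 =
      4 / 2 ^ piX x * ∏ p ∈ primesUpTo x, (1 - (p : ℝ)⁻¹) := by
  have h2 : 2 ∈ primesUpTo x := mem_primesUpTo.2 ⟨Nat.prime_two, by exact_mod_cast hx⟩
  have h : ∏ p ∈ primesUpTo x, (1 - (p : ℝ)⁻¹) / 2 =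
      (∏ p ∈ primesUpTo x, (1 - (p : ℝ)⁻¹)) / 2 ^ piX x := by
    rw [Finset.prod_div_distrib, Finset.prod_const, piX]
  rw [← Finset.mul_prod_erase _ _ h2] at h
  push_cast at h
  rw [div_mul_eq_mul_div, mul_div_assoc, ← h]
  ring

/-- The number of `x`-pseudosquares up to `M(x)` with an explicit error term. -/
theorem abs_pseudosquaresIn_sub_le {x : ℝ} (hx : 2 ≤ x) :
    |(pseudosquaresIn x 0 (Mx x) : ℝ) -
        Mx x / 2 ^ (piX x + 1) * ∏ p ∈ primesUpTo x, (1 - (p : ℝ)⁻¹)| ≤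
      √(Mx x) * (2 ^ piX x * (1 + Real.log (Mx x))) + √(Mx x) + 1 := by
  have h1 := abs_pseudosquaresIn_sub_card_residueSet_le x
  have h2 := abs_card_residueSet_sub_le x ((Mx x + 7) / 8)
  set N := (Mx x + 7) / 8 with hN
  set V := ∏ p ∈ (primesUpTo x).erase 2, (1 - (p : ℝ)⁻¹) / 2 with hV
  have hfac : ∀ p ∈ (primesUpTo x).erase 2, 0 ≤ (1 - (p : ℝ)⁻¹) / 2 ∧
      (1 - (p : ℝ)⁻¹) / 2 ≤ 1 := fun p _ ↦ by
    have := Nat.cast_inv_le_one (α := ℝ) p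
    have : (0 : ℝ) ≤ (p : ℝ)⁻¹ := by positivity
    constructor <;> linarith
  have hV0 : 0 ≤ V := Finset.prod_nonneg fun p hp ↦ (hfac p hp).1
  have hV1 : V ≤ 1 := Finset.prod_le_one (fun p hp ↦ (hfac p hp).1) fun p hp ↦ (hfac p hp).2
  have hmain : (Mx x : ℝ) / 2 ^ (piX x + 1) * ∏ p ∈ primesUpTo x, (1 - (p : ℝ)⁻¹) =
      Mx x / 8 * V := by
    rw [hV, prod_erase_two_eq hx, pow_succ]
    field_simp
    ring
  have hN1 : (Mx x : ℝ) ≤ 8 * N := by exact_mod_cast (by omega : Mx x ≤ 8 * N)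
  have hN2 : 8 * (N : ℝ) ≤ Mx x + 8 := by exact_mod_cast (by omega : 8 * N ≤ Mx x + 8)
  have h3 : |(N : ℝ) * V - Mx x / 8 * V| ≤ 1 := by
    rw [← sub_mul, abs_mul, abs_of_nonneg hV0, abs_of_nonneg (by linarith)]
    exact mul_le_one₀ (by linarith) hV0 hV1
  rw [hmain]
  rw [abs_le] at *
  constructor <;> linarith

theorem Mx_eq_primorial (x : ℝ) : Mx x = primorial ⌊x⌋₊ := by
  rw [Mx, primesUpTo, primorial, Nat.range_succ_eq_Iic]

theorem piX_eq_primeCounting (x : ℝ) : piX x = Nat.primeCounting ⌊x⌋₊ := by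
  rw [piX, primesUpTo, ← Nat.range_succ_eq_Iic, Nat.primeCounting, Nat.primeCounting',
    Nat.count_eq_card_filter_range]

theorem eventually_half_mul_le_theta : ∀ᶠ x : ℝ in atTop, x / 2 ≤ Chebyshev.theta x := by
  have hlog : (fun x : ℝ ↦ √x * Real.log x) =o[atTop] fun x : ℝ ↦ x := by
    have h := (Asymptotics.isBigO_refl (fun x : ℝ ↦ √x) atTop).mul_isLittleO
      (isLittleO_log_rpow_atTop (r := 1 / 2) (by norm_num))
    refine h.congr' EventuallyEq.rfl ?_
    filter_upwards [eventually_ge_atTop 0] with x hx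
    rw [← Real.sqrt_eq_rpow, Real.mul_self_sqrt hx]
  filter_upwards [hlog.bound (c := 1 / 100) (by norm_num), eventually_ge_atTop 100] with x h1 h2
  have h3 := Chebyshev.theta_ge' (x := x) (by linarith)
  have h4 : Real.log (x + 2) ≤ √x * Real.log x := by
    have h5 : Real.log (x + 2) ≤ Real.log (x ^ 2) :=
      Real.log_le_log (by linarith) (by nlinarith)
    rw [Real.log_pow] at h5
    have h6 : 2 ≤ √x := Real.le_sqrt_of_sq_le (by linarith)
    have h7 : 0 ≤ Real.log x := Real.log_nonneg (by linarith)
    push_cast at h5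
    nlinarith
  rw [Real.norm_eq_abs, Real.norm_of_nonneg (by linarith)] at h1
  have h8 := (le_abs_self _).trans h1
  have := Real.log_two_gt_d9
  nlinarith

theorem eventually_piX_mul_log_four_le : ∀ᶠ x : ℝ in atTop, piX x * Real.log 4 ≤ x / 16 := by
  have hlog4 : 0 < Real.log 4 := Real.log_pos (by norm_num)
  filter_upwards [Chebyshev.eventually_primeCounting_le one_pos, eventually_gt_atTop 1,
    Real.tendsto_log_atTop.eventually_ge_atTop (16 * (Real.log 4 + 1) * Real.log 4)]
    with x h1 h2 h3
  have hlog : 0 < Real.log x := Real.log_pos h2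
  rw [piX_eq_primeCounting]
  calc (Nat.primeCounting ⌊x⌋₊ : ℝ) * Real.log 4
      ≤ (Real.log 4 + 1) * x / Real.log x * Real.log 4 := by gcongr
    _ ≤ x / 16 := by
      rw [div_mul_eq_mul_div, div_le_iff₀ hlog]
      nlinarith

theorem tendsto_error_term_zero :
    Tendsto (fun x ↦ (√(Mx x) * (2 ^ piX x * (1 + Real.log (Mx x))) + √(Mx x) + 1) *
      (2 ^ (piX x + 1) * Real.log x) / Mx x) atTop (𝓝 0) := by
  have hlim : Tendsto (fun x : ℝ ↦ 18 * (x ^ 2 * Real.exp (-(3 / 16) * x))) atTop (𝓝 0) := by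
    have h := tendsto_rpow_mul_exp_neg_mul_atTop_nhds_zero 2 (3 / 16) (by norm_num)
    simpa using h.const_mul 18
  refine squeeze_zero' ?_ ?_ hlim
  · filter_upwards [eventually_ge_atTop 1] with x hx
    have := Real.log_nonneg hx
    have := Real.log_natCast_nonneg (Mx x)
    positivity
  filter_upwards [eventually_half_mul_le_theta, eventually_piX_mul_log_four_le,
    eventually_ge_atTop 1] with x hθ hπ hx
  have hlog0 := Real.log_nonneg hx
  have hθ4 := Chebyshev.theta_le_log4_mul_x (x := x) (by linarith)
  rw [Chebyshev.theta_eq_log_primorial, ← Mx_eq_primorial] at hθ hθ4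
  have hM : (1 : ℝ) ≤ Mx x := by exact_mod_cast Mx_pos x
  have hM0 : (0 : ℝ) < Mx x := by linarith
  have hs : 1 ≤ √(Mx x : ℝ) := Real.one_le_sqrt.2 hM
  have hs0 : 0 < √(Mx x : ℝ) := by linarith
  have hL : 0 ≤ Real.log (Mx x) := Real.log_nonneg hM
  have h2 : (1 : ℝ) ≤ 2 ^ piX x := one_le_pow₀ (by norm_num)
  have hlog4 : Real.log 4 ≤ 2 := by
    rw [show (4 : ℝ) = 2 ^ 2 by norm_num, Real.log_pow]
    have := Real.log_two_lt_d9
    push_cast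
    linarith
  have h4 : (4 : ℝ) ^ piX x ≤ Real.exp (x / 16) := by
    rw [← Real.exp_log (show (0 : ℝ) < 4 ^ piX x by positivity), Real.log_pow]
    exact Real.exp_le_exp.2 hπ
  have hsM : Real.exp (x / 4) ≤ √(Mx x : ℝ) := by
    rw [Real.le_sqrt' (Real.exp_pos _), ← Real.exp_nat_mul, ← Real.le_log_iff_exp_le hM0]
    push_cast
    linarith
  have hone : 1 + Real.log (Mx x) ≤ 3 * x := by nlinarith
  have hbracket : √(Mx x : ℝ) * (2 ^ piX x * (1 + Real.log (Mx x))) + √(Mx x) + 1 ≤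
      3 * (√(Mx x) * (2 ^ piX x * (1 + Real.log (Mx x)))) := by
    have : √(Mx x : ℝ) ≤ √(Mx x) * (2 ^ piX x * (1 + Real.log (Mx x))) :=
      le_mul_of_one_le_right hs0.le (one_le_mul_of_one_le_of_one_le h2 (by linarith))
    linarith
  calc (√(Mx x : ℝ) * (2 ^ piX x * (1 + Real.log (Mx x))) + √(Mx x) + 1) *
        (2 ^ (piX x + 1) * Real.log x) / Mx x
      ≤ 3 * (√(Mx x) * (2 ^ piX x * (1 + Real.log (Mx x)))) *
        (2 ^ (piX x + 1) * Real.log x) / Mx x := by gcongr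
    _ = 6 * (4 ^ piX x * (1 + Real.log (Mx x)) * Real.log x) / √(Mx x) := by
      rw [div_eq_div_iff hM0.ne' hs0.ne', show (4 : ℝ) ^ piX x = 2 ^ piX x * 2 ^ piX x by
        rw [← mul_pow]; norm_num, pow_succ]
      linear_combination 6 * 2 ^ piX x * (1 + Real.log (Mx x)) * 2 ^ piX x * Real.log x *
        Real.mul_self_sqrt hM0.le
    _ ≤ 6 * (Real.exp (x / 16) * (3 * x) * x) / Real.exp (x / 4) := by
      have := Real.log_le_self (x := x) (by linarith)
      gcongr
    _ = 18 * (x ^ 2 * Real.exp (-(3 / 16) * x)) := by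
      rw [show -(3 / 16) * x = x / 16 - x / 4 by ring, Real.exp_sub]
      ring

/-- **Mertens' third theorem**. -/
theorem tendsto_prod_one_sub_inv_mul_log :
    Tendsto (fun x : ℝ ↦ (∏ p ∈ primesUpTo x, (1 - (p : ℝ)⁻¹)) *
      (Real.exp Real.eulerMascheroniConstant * Real.log x)) atTop (𝓝 1) := by
  have h := (Real.continuous_exp.tendsto _).comp
    tendsto_sum_neg_log_one_sub_prime_inv_sub_log_log.neg
  have h' := h.mul_const (Real.exp Real.eulerMascheroniConstant)
  rw [← Real.exp_add, neg_add_cancel, Real.exp_zero] at h'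
  refine h'.congr' ?_
  filter_upwards [eventually_gt_atTop 1] with x hx
  have hprod : ∑ n ∈ Finset.Ioc 0 ⌊x⌋₊, (if n.Prime then -Real.log (1 - (n : ℝ)⁻¹) else 0) =
      -Real.log (∏ p ∈ primesUpTo x, (1 - (p : ℝ)⁻¹)) := by
    rw [← Finset.sum_filter, Real.log_prod, ← Finset.sum_neg_distrib]
    · refine Finset.sum_congr ?_ fun _ _ ↦ rfl
      ext p
      simp only [primesUpTo, Finset.mem_filter, Finset.mem_Ioc, Finset.mem_Iic]
      exact ⟨fun h ↦ ⟨h.1.2, h.2⟩, fun h ↦ ⟨⟨h.2.pos, h.1⟩, h.2⟩⟩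
    · intro p hp
      have := (mem_primesUpTo.1 hp).1.inv_le_half
      linarith
  have hpos : 0 < ∏ p ∈ primesUpTo x, (1 - (p : ℝ)⁻¹) := Finset.prod_pos fun p hp ↦ by
    have := (mem_primesUpTo.1 hp).1.inv_le_half
    linarith
  simp only [Function.comp_apply]
  rw [hprod, neg_sub, sub_neg_eq_add, Real.exp_add, Real.exp_log hpos,
    Real.exp_log (Real.log_pos hx)]
  ring

/-- As `x → ∞`,
`#(S_x ∩ (0, M(x)]) = (1+o(1)) · M(x) / (2^{π(x)+1} e^γ log x)`. -/
theorem pseudosquares_count_asymptotic :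
    ∀ ε : ℝ, 0 < ε → ∃ x₀ : ℝ, ∀ x : ℝ, x₀ ≤ x →
      |(pseudosquaresIn x 0 (Mx x) : ℝ) -
          (Mx x : ℝ) / (2 ^ (piX x + 1) *
            Real.exp Real.eulerMascheroniConstant * Real.log x)| ≤
        ε * ((Mx x : ℝ) / (2 ^ (piX x + 1) *
            Real.exp Real.eulerMascheroniConstant * Real.log x)) := by
  intro ε hε
  have hev := ((tendsto_error_term_zero.mul_const
    (Real.exp Real.eulerMascheroniConstant)).eventually_le_const
      (show 0 * Real.exp Real.eulerMascheroniConstant < ε / 2 by linarith)).and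
    (tendsto_prod_one_sub_inv_mul_log.eventually (Metric.closedBall_mem_nhds 1 (half_pos hε)))
  obtain ⟨x₀, hx₀⟩ := eventually_atTop.1 (hev.and (eventually_ge_atTop 2))
  refine ⟨x₀, fun x hx ↦ ?_⟩
  obtain ⟨⟨h1, h2⟩, h3⟩ := hx₀ x hx
  rw [Real.dist_eq] at h2
  have h4 := abs_pseudosquaresIn_sub_le h3
  set R := √(Mx x : ℝ) * (2 ^ piX x * (1 + Real.log (Mx x))) + √(Mx x) + 1
  set V := ∏ p ∈ primesUpTo x, (1 - (p : ℝ)⁻¹)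
  set g := Real.exp Real.eulerMascheroniConstant
  have hg : 0 < g := Real.exp_pos _
  have hlog : 0 < Real.log x := Real.log_pos (by linarith)
  have hM : (0 : ℝ) < Mx x := by exact_mod_cast Mx_pos x
  set D := (Mx x : ℝ) / (2 ^ (piX x + 1) * g * Real.log x) with hD
  have hD0 : 0 < D := by positivity
  have hR : R ≤ ε / 2 * D := by
    calc R = R * (2 ^ (piX x + 1) * Real.log x) / Mx x * g * D := by
          rw [hD]
          field_simp
      _ ≤ ε / 2 * D := by gcongr
  have hV : |Mx x / 2 ^ (piX x + 1) * V - D| ≤ ε / 2 * D := by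
    have : (Mx x : ℝ) / 2 ^ (piX x + 1) * V - D = (V * (g * Real.log x) - 1) * D := by
      rw [hD]
      field_simp
    rw [this, abs_mul, abs_of_pos hD0]
    gcongr
  have := abs_sub_le (pseudosquaresIn x 0 (Mx x) : ℝ) (Mx x / 2 ^ (piX x + 1) * V) D
  linarith
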